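/- arXiv:1009.1909 — 4 statements merged into one kernel-verified Lean document; each statement's English description precedes it below -/
import Mathlib

section
/- Suppose Ψ satisfies Assumption 1 and the design problem has an optimal solution w* with M(w*) positive definite. Fix C > 0. Let (μ_j) be positive reals with μ_j → 0 and (v_j) ⊂ ℝ^{n−1} with ‖v_j‖_∞ < Cμ_j for all j, and suppose w(μ_j, v_j) → w⋄. Then w⋄ is an optimal solution of the design problem of maximum cardinality; in particular, for every optimal solution w' and every index i with w'_i > 0, one has w⋄_i > 0 whenever w' has maximum cardinality, and the support of w⋄ has the greatest size among supports of optimal solutions. -/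
open Matrix Filter Topology

noncomputable section

attribute [local instance] Matrix.normedAddCommGroup Matrix.normedSpace

/-- Assumption 1: `Ψ` is convex, decreasing, twice continuously differentiable and bounded
below on the set of `k × k` real symmetric positive definite matrices, and `Ψ (X j) → ∞`
whenever `(X j)` is a bounded sequence of positive definite matrices whose smallest
eigenvalues tend to `0`.  (Over `ℝ`, `Matrix.PosDef` includes symmetry.) -/
structure Assumption1 (k : ℕ) (Ψ : Matrix (Fin k) (Fin k) ℝ → ℝ) : Prop where
  convex : ∀ A B : Matrix (Fin k) (Fin k) ℝ, A.PosDef → B.PosDef →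
    ∀ t : ℝ, 0 ≤ t → t ≤ 1 → Ψ (t • A + (1 - t) • B) ≤ t * Ψ A + (1 - t) * Ψ B
  decreasing : ∀ A B : Matrix (Fin k) (Fin k) ℝ, A.IsHermitian → B.PosDef →
    (A - B).PosSemidef → Ψ A ≤ Ψ B
  smooth : ContDiffOn ℝ 2 Ψ {U : Matrix (Fin k) (Fin k) ℝ | U.PosDef}
  bddBelow : ∃ c : ℝ, ∀ U : Matrix (Fin k) (Fin k) ℝ, U.PosDef → c ≤ Ψ U
  blowup : ∀ (X : ℕ → Matrix (Fin k) (Fin k) ℝ) (hp : ∀ j, (X j).PosDef),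
    (∃ C : ℝ, ∀ j i l, |X j i l| ≤ C) →
    Tendsto (fun j => ⨅ i, (hp j).isHermitian.eigenvalues i) atTop (𝓝 0) →
    Tendsto (fun j => Ψ (X j)) atTop atTop

/-- The simplex of designs. -/
def Omega (n : ℕ) : Set (Fin n → ℝ) := {w | (∀ i, 0 ≤ w i) ∧ ∑ i, w i = 1}

/-- The moment matrix `M(w) = ∑ i, w i • A i`. -/
def Mmat {n m : ℕ} (A : Fin n → Matrix (Fin m) (Fin m) ℝ) (w : Fin n → ℝ) :
    Matrix (Fin m) (Fin m) ℝ := ∑ i, w i • A i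

/-- `Range K ⊆ Range X`. -/
def RangeIncl {m k : ℕ} (K : Matrix (Fin m) (Fin k) ℝ) (X : Matrix (Fin m) (Fin m) ℝ) : Prop :=
  LinearMap.range (Matrix.toLin' K) ≤ LinearMap.range (Matrix.toLin' X)

/-- `Φ̂(X) = inf {Ψ U | U symmetric positive definite, X - K U Kᵀ positive semidefinite}`. -/
def PhiHat {m k : ℕ} (K : Matrix (Fin m) (Fin k) ℝ) (Ψ : Matrix (Fin k) (Fin k) ℝ → ℝ)
    (X : Matrix (Fin m) (Fin m) ℝ) : ℝ :=
  sInf {y | ∃ U : Matrix (Fin k) (Fin k) ℝ, U.PosDef ∧ (X - K * U * Kᵀ).PosSemidef ∧ y = Ψ U}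

/-- The optimal value `f*` of the design problem. -/
def fstar {n m k : ℕ} (A : Fin n → Matrix (Fin m) (Fin m) ℝ) (K : Matrix (Fin m) (Fin k) ℝ)
    (Ψ : Matrix (Fin k) (Fin k) ℝ → ℝ) : ℝ :=
  sInf {y | ∃ w ∈ Omega n, RangeIncl K (Mmat A w) ∧ y = PhiHat K Ψ (Mmat A w)}

/-- `w` is an optimal solution of the design problem. -/
def IsOptimal {n m k : ℕ} (A : Fin n → Matrix (Fin m) (Fin m) ℝ) (K : Matrix (Fin m) (Fin k) ℝ)
    (Ψ : Matrix (Fin k) (Fin k) ℝ → ℝ) (w : Fin n → ℝ) : Prop :=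
  w ∈ Omega n ∧ RangeIncl K (Mmat A w) ∧ PhiHat K Ψ (Mmat A w) = fstar A K Ψ

/-- The open domain `D` of the barrier subproblem. -/
def Dset (n : ℕ) : Set (Fin (n - 1) → ℝ) := {wt | (∀ i, 0 < wt i) ∧ ∑ i, wt i < 1}

/-- `w(w̃) = (w̃₁, …, w̃_{n-1}, 1 - ∑ w̃ᵢ)`. -/
def extendW (n : ℕ) (wt : Fin (n - 1) → ℝ) : Fin n → ℝ :=
  fun i => if h : (i : ℕ) < n - 1 then wt ⟨i, h⟩ else 1 - ∑ j, wt j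

/-- The log-barrier function `f_μ`. -/
def fmu {n m k : ℕ} (A : Fin n → Matrix (Fin m) (Fin m) ℝ) (K : Matrix (Fin m) (Fin k) ℝ)
    (Ψ : Matrix (Fin k) (Fin k) ℝ → ℝ) (μ : ℝ) (wt : Fin (n - 1) → ℝ) : ℝ :=
  Ψ ((Kᵀ * (Mmat A (extendW n wt))⁻¹ * K)⁻¹)
    - μ * ∑ i, Real.log (wt i) - μ * Real.log (1 - ∑ i, wt i)

lemma mulVec_inj_of_rank {m k : ℕ} (K : Matrix (Fin m) (Fin k) ℝ) (hK : K.rank = k) :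
    Function.Injective K.mulVec := by
  have h := LinearMap.finrank_range_add_finrank_ker K.mulVecLin
  have h1 : Module.finrank ℝ (LinearMap.range K.mulVecLin) = k := hK
  rw [h1] at h
  have h2 : Module.finrank ℝ (LinearMap.ker K.mulVecLin) = 0 := by
    simp at h; simpa using h
  have h3 : LinearMap.ker K.mulVecLin = ⊥ := Submodule.finrank_eq_zero.mp h2
  have := LinearMap.ker_eq_bot.mp h3
  exact this

lemma S_posDef {m k : ℕ} (K : Matrix (Fin m) (Fin k) ℝ) (hK : K.rank = k)
    {X : Matrix (Fin m) (Fin m) ℝ} (hX : X.PosDef) : (Kᵀ * X⁻¹ * K).PosDef := by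
  have := hX.inv.conjTranspose_mul_mul_same (mulVec_inj_of_rank K hK)
  simpa using this

lemma U0_feasible {m k : ℕ} (K : Matrix (Fin m) (Fin k) ℝ) (hK : K.rank = k)
    {X : Matrix (Fin m) (Fin m) ℝ} (hX : X.PosDef) :
    (X - K * (Kᵀ * X⁻¹ * K)⁻¹ * Kᵀ).PosSemidef := by
  have hS := S_posDef K hK hX
  have := hX.isUnit.invertible
  have := hS.isUnit.invertible
  have h1 := Matrix.PosDef.fromBlocks₁₁ K (Kᵀ * X⁻¹ * K) hX
  have h2 := Matrix.PosDef.fromBlocks₂₂ X K hS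
  simp only [conjTranspose_eq_transpose_of_trivial] at h1 h2
  rw [← h2, h1, sub_self]
  exact PosSemidef.zero

lemma feasible_le_U0 {m k : ℕ} (K : Matrix (Fin m) (Fin k) ℝ) (hK : K.rank = k)
    {X : Matrix (Fin m) (Fin m) ℝ} (hX : X.PosDef) {U : Matrix (Fin k) (Fin k) ℝ}
    (hU : U.PosDef) (h : (X - K * U * Kᵀ).PosSemidef) :
    ((Kᵀ * X⁻¹ * K)⁻¹ - U).PosSemidef := by
  have hS := S_posDef K hK hX
  have := hX.isUnit.invertible
  have := hU.isUnit.invertible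
  have := hU.inv.isUnit.invertible
  have := hS.inv.isUnit.invertible
  have hUU : U⁻¹⁻¹ = U := by simp
  have hSS : (Kᵀ * X⁻¹ * K)⁻¹⁻¹ = (Kᵀ * X⁻¹ * K) :=
    Matrix.nonsing_inv_nonsing_inv _ ((Matrix.isUnit_iff_isUnit_det _).mp hS.isUnit)
  have h1 := Matrix.PosDef.fromBlocks₁₁ K U⁻¹ hX
  have h2 := Matrix.PosDef.fromBlocks₂₂ X K hU.inv
  have h3 := Matrix.PosDef.fromBlocks₁₁ (1 : Matrix (Fin k) (Fin k) ℝ) (Kᵀ * X⁻¹ * K)⁻¹ hU.inv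
  have h4 := Matrix.PosDef.fromBlocks₂₂ U⁻¹ (1 : Matrix (Fin k) (Fin k) ℝ) hS.inv
  rw [hUU] at h2 h3
  rw [hSS] at h4
  simp only [conjTranspose_eq_transpose_of_trivial, transpose_one, one_mul, mul_one]
    at h1 h2 h3 h4
  exact h3.mp (h4.mpr (h1.mp (h2.mpr h)))

lemma PhiHat_bdd {m k : ℕ} (K : Matrix (Fin m) (Fin k) ℝ) (Ψ : Matrix (Fin k) (Fin k) ℝ → ℝ)
    (hΨ : Assumption1 k Ψ) (X : Matrix (Fin m) (Fin m) ℝ) :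
    BddBelow {y | ∃ U : Matrix (Fin k) (Fin k) ℝ, U.PosDef ∧
      (X - K * U * Kᵀ).PosSemidef ∧ y = Ψ U} := by
  obtain ⟨c, hc⟩ := hΨ.bddBelow
  refine ⟨c, ?_⟩
  rintro y ⟨U, hU, _, rfl⟩
  exact hc U hU

lemma PhiHat_eq {m k : ℕ} (K : Matrix (Fin m) (Fin k) ℝ) (hK : K.rank = k)
    (Ψ : Matrix (Fin k) (Fin k) ℝ → ℝ) (hΨ : Assumption1 k Ψ)
    {X : Matrix (Fin m) (Fin m) ℝ} (hX : X.PosDef) :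
    PhiHat K Ψ X = Ψ ((Kᵀ * X⁻¹ * K)⁻¹) := by
  have hU0 := (S_posDef K hK hX).inv
  apply le_antisymm
  · exact csInf_le (PhiHat_bdd K Ψ hΨ X) ⟨_, hU0, U0_feasible K hK hX, rfl⟩
  · refine le_csInf ⟨_, _, hU0, U0_feasible K hK hX, rfl⟩ ?_
    rintro y ⟨U, hU, hf, rfl⟩
    exact hΨ.decreasing _ _ hU0.isHermitian hU (feasible_le_U0 K hK hX hU hf)

lemma feasible_nonempty {m k : ℕ} (K : Matrix (Fin m) (Fin k) ℝ)
    {X : Matrix (Fin m) (Fin m) ℝ} (hX : X.PosSemidef) (hR : RangeIncl K X) :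
    ∃ U : Matrix (Fin k) (Fin k) ℝ, U.PosDef ∧ (X - K * U * Kᵀ).PosSemidef := by
  have hL : ∃ L : Matrix (Fin m) (Fin k) ℝ, X * L = K := by
    have : ∀ j : Fin k, ∃ y : Fin m → ℝ, X *ᵥ y = fun i => K i j := by
      intro j
      have h1 : (fun i => K i j) ∈ LinearMap.range (Matrix.toLin' K) :=
        ⟨Pi.single j 1, by ext i; simp⟩
      obtain ⟨y, hy⟩ := hR h1
      exact ⟨y, by simpa using hy⟩
    choose y hy using this
    refine ⟨Matrix.of fun i j => y j i, ?_⟩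
    ext i j
    exact congrFun (hy j) i
  obtain ⟨L, rfl⟩ := hL
  have hXt : Xᵀ = X := by
    have h := hX.isHermitian.eq
    rwa [conjTranspose_eq_transpose_of_trivial] at h
  have hV : (Lᵀ * X * L + 1).PosDef := by
    have := hX.conjTranspose_mul_mul_same L
    simp only [conjTranspose_eq_transpose_of_trivial] at this
    exact PosDef.one.posSemidef_add this
  refine ⟨(Lᵀ * X * L + 1)⁻¹, hV.inv, ?_⟩
  have := hV.isUnit.invertible
  have h2 := Matrix.PosDef.fromBlocks₂₂ X (X * L) hV
  simp only [conjTranspose_eq_transpose_of_trivial] at h2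
  rw [← h2]
  have h3 := hX.conjTranspose_mul_mul_same (fromCols (1 : Matrix (Fin m) (Fin m) ℝ) L)
  have h4 : (diagonal (Sum.elim (fun _ => 0) (fun _ => 1)) :
      Matrix (Fin m ⊕ Fin k) (Fin m ⊕ Fin k) ℝ).PosSemidef := by
    apply PosSemidef.diagonal
    rintro (i | i) <;> simp
  have h5 : (diagonal (Sum.elim (fun _ => 0) (fun _ => 1)) :
      Matrix (Fin m ⊕ Fin k) (Fin m ⊕ Fin k) ℝ) = fromBlocks 0 0 0 1 := by
    rw [← fromBlocks_diagonal]; simp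
  have h6 : fromBlocks X (X * L) (X * L)ᵀ (Lᵀ * X * L + 1) =
      (fromCols (1 : Matrix (Fin m) (Fin m) ℝ) L)ᴴ * X *
        (fromCols (1 : Matrix (Fin m) (Fin m) ℝ) L) +
      diagonal (Sum.elim (fun _ => 0) (fun _ => 1)) := by
    rw [h5, conjTranspose_eq_transpose_of_trivial, transpose_fromCols, fromRows_mul,
      fromRows_mul_fromCols, fromBlocks_add]
    simp [hXt, Matrix.mul_assoc]
  rw [h6]
  exact h3.add h4

lemma rangeIncl_of_posDef {m k : ℕ} (K : Matrix (Fin m) (Fin k) ℝ)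
    {X : Matrix (Fin m) (Fin m) ℝ} (hX : X.PosDef) : RangeIncl K X := by
  rintro y -
  refine ⟨X⁻¹ *ᵥ y, ?_⟩
  rw [toLin'_apply, mulVec_mulVec,
    Matrix.mul_nonsing_inv _ ((Matrix.isUnit_iff_isUnit_det _).mp hX.isUnit), one_mulVec]

lemma Mmat_posSemidef {n m : ℕ} (A : Fin n → Matrix (Fin m) (Fin m) ℝ)
    (hA : ∀ i, (A i).PosSemidef) (w : Fin n → ℝ) (hw : ∀ i, 0 ≤ w i) :
    (Mmat A w).PosSemidef :=
  posSemidef_sum _ fun i _ => (hA i).smul (hw i)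

lemma Mmat_comb {n m : ℕ} (A : Fin n → Matrix (Fin m) (Fin m) ℝ) (w w' : Fin n → ℝ) (a b : ℝ) :
    Mmat A (fun i => a * w i + b * w' i) = a • Mmat A w + b • Mmat A w' := by
  simp only [Mmat, Finset.smul_sum, ← Finset.sum_add_distrib, add_smul, mul_smul]

lemma Mmat_posDef_of_ge {n m : ℕ} (A : Fin n → Matrix (Fin m) (Fin m) ℝ)
    (hA : ∀ i, (A i).PosSemidef) (w w' : Fin n → ℝ) (hw : (Mmat A w).PosDef)
    (c : ℝ) (hc : 0 < c) (h : ∀ i, c * w i ≤ w' i) : (Mmat A w').PosDef := by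
  have h1 : Mmat A w' = c • Mmat A w + (1:ℝ) • Mmat A (fun i => w' i - c * w i) := by
    rw [← Mmat_comb]; congr 1; ext i; ring
  rw [h1, one_smul]
  exact (hw.smul hc).add_posSemidef (Mmat_posSemidef A hA _ fun i => sub_nonneg.2 (h i))

lemma Mmat_posDef_of_pos {n m : ℕ} (hn : 0 < n) (A : Fin n → Matrix (Fin m) (Fin m) ℝ)
    (hA : ∀ i, (A i).PosSemidef) (w w' : Fin n → ℝ) (hwO : w ∈ Omega n) (hw : (Mmat A w).PosDef)
    (h : ∀ i, 0 < w' i) : (Mmat A w').PosDef := by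
  have : Nonempty (Fin n) := ⟨⟨0, hn⟩⟩
  obtain ⟨i0, hi0⟩ := Finite.exists_min w'
  refine Mmat_posDef_of_ge A hA w w' hw (w' i0) (h i0) fun i => ?_
  have h1 : w i ≤ 1 := by
    rw [← hwO.2]
    exact Finset.single_le_sum (f := w) (fun j _ => hwO.1 j) (Finset.mem_univ i)
  calc w' i0 * w i ≤ w' i0 * 1 := by gcongr; exact (h i0).le
    _ ≤ w' i := by simpa using hi0 i

lemma fstar_le {n m k : ℕ} (A : Fin n → Matrix (Fin m) (Fin m) ℝ) (K : Matrix (Fin m) (Fin k) ℝ)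
    (Ψ : Matrix (Fin k) (Fin k) ℝ → ℝ) (hΨ : Assumption1 k Ψ) (w : Fin n → ℝ)
    (hw : w ∈ Omega n) (hR : RangeIncl K (Mmat A w)) : fstar A K Ψ ≤ PhiHat K Ψ (Mmat A w) := by
  refine csInf_le ?_ ⟨w, hw, hR, rfl⟩
  obtain ⟨c, hc⟩ := hΨ.bddBelow
  refine ⟨min c 0, ?_⟩
  rintro y ⟨w, hw, hR, rfl⟩
  by_cases hne : {y | ∃ U : Matrix (Fin k) (Fin k) ℝ, U.PosDef ∧
      (Mmat A w - K * U * Kᵀ).PosSemidef ∧ y = Ψ U}.Nonempty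
  · refine le_csInf hne ?_
    rintro y ⟨U, hU, _, rfl⟩
    exact (min_le_left _ _).trans (hc U hU)
  · rw [PhiHat, Set.not_nonempty_iff_eq_empty.mp hne, Real.sInf_empty]
    exact min_le_right _ _

lemma PhiHat_convex {m k : ℕ} (K : Matrix (Fin m) (Fin k) ℝ) (hK : K.rank = k)
    (Ψ : Matrix (Fin k) (Fin k) ℝ → ℝ) (hΨ : Assumption1 k Ψ)
    {X Y : Matrix (Fin m) (Fin m) ℝ} (hX : X.PosDef) (hY : Y.PosSemidef) (hR : RangeIncl K Y)
    (t : ℝ) (ht0 : 0 < t) (ht1 : t < 1) :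
    PhiHat K Ψ ((1 - t) • X + t • Y) ≤ (1 - t) * PhiHat K Ψ X + t * PhiHat K Ψ Y := by
  have hU0 := (S_posDef K hK hX).inv
  have hf0 := U0_feasible K hK hX
  rw [PhiHat_eq K hK Ψ hΨ hX]
  set U0 := (Kᵀ * X⁻¹ * K)⁻¹
  suffices h : (PhiHat K Ψ ((1 - t) • X + t • Y) - (1 - t) * Ψ U0) / t ≤ PhiHat K Ψ Y by
    rw [div_le_iff₀ ht0] at h; linarith
  obtain ⟨U, hU, hf⟩ := feasible_nonempty K hY hR
  refine le_csInf ⟨_, U, hU, hf, rfl⟩ ?_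
  rintro y ⟨U, hU, hf, rfl⟩
  rw [div_le_iff₀ ht0]
  have h1 : PhiHat K Ψ ((1 - t) • X + t • Y) ≤ Ψ (t • U + (1 - t) • U0) := by
    refine csInf_le (PhiHat_bdd K Ψ hΨ _) ⟨_, ?_, ?_, rfl⟩
    · exact (hU.smul ht0).add (hU0.smul (sub_pos.2 ht1))
    · convert (hf.smul ht0.le).add (hf0.smul (sub_pos.2 ht1).le) using 1
      simp only [Matrix.mul_add, Matrix.add_mul, Matrix.mul_smul, Matrix.smul_mul, smul_sub]
      abel
  have h2 := hΨ.convex U U0 hU hU0 t ht0.le ht1.le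
  linarith

lemma sum_extendW (n : ℕ) (hn : 1 ≤ n) (wt : Fin (n - 1) → ℝ) (F : ℝ → ℝ) :
    ∑ i, F (extendW n wt i) = ∑ i, F (wt i) + F (1 - ∑ i, wt i) := by
  obtain ⟨p, rfl⟩ : ∃ p, n = p + 1 := ⟨n - 1, by omega⟩
  rw [Fin.sum_univ_castSucc]
  simp [extendW]

lemma extendW_pos (n : ℕ) (wt : Fin (n - 1) → ℝ) (h : wt ∈ Dset n) (i : Fin n) :
    0 < extendW n wt i := by
  unfold extendW
  split_ifs with hi
  · exact h.1 _
  · linarith [h.2]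

lemma extendW_Omega (n : ℕ) (hn : 1 ≤ n) (wt : Fin (n - 1) → ℝ) (h : wt ∈ Dset n) :
    extendW n wt ∈ Omega n := by
  refine ⟨fun i => (extendW_pos n wt h i).le, ?_⟩
  have := sum_extendW n hn wt id
  simp only [id] at this
  rw [this]; ring

lemma sum_split (n : ℕ) (hn : 1 ≤ n) (w : Fin n → ℝ) :
    ∑ i, w i = ∑ i : Fin (n - 1), w ⟨i, by omega⟩ + w ⟨n - 1, by omega⟩ := by
  obtain ⟨p, rfl⟩ : ∃ p, n = p + 1 := ⟨n - 1, by omega⟩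
  rw [Fin.sum_univ_castSucc]
  rfl

/-- restriction to the first coordinates -/
def restr (n : ℕ) (w : Fin n → ℝ) : Fin (n - 1) → ℝ := fun i => w ⟨i, by omega⟩

lemma extendW_restr (n : ℕ) (hn : 1 ≤ n) (w : Fin n → ℝ) (hw : ∑ i, w i = 1) :
    extendW n (restr n w) = w := by
  ext i
  unfold extendW
  split_ifs with hi
  · rfl
  · have h1 := sum_split n hn w
    have h2 : i = ⟨n - 1, by omega⟩ := by ext; simp; omega
    rw [hw] at h1
    rw [h2]
    simp only [restr]
    linarith

lemma restr_extendW (n : ℕ) (wt : Fin (n - 1) → ℝ) : restr n (extendW n wt) = wt := by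
  ext i
  simp [restr, extendW]

lemma restr_Dset (n : ℕ) (hn : 1 ≤ n) (w : Fin n → ℝ) (hw : ∑ i, w i = 1) (hp : ∀ i, 0 < w i) :
    restr n w ∈ Dset n := by
  refine ⟨fun i => hp _, ?_⟩
  have h1 := sum_split n hn w
  have h2 := hp ⟨n - 1, by omega⟩
  simp only [restr]
  linarith

lemma fmu_eq {n m k : ℕ} (hn : 1 ≤ n) (A : Fin n → Matrix (Fin m) (Fin m) ℝ)
    (K : Matrix (Fin m) (Fin k) ℝ) (hK : K.rank = k) (Ψ : Matrix (Fin k) (Fin k) ℝ → ℝ)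
    (hΨ : Assumption1 k Ψ) (μ : ℝ) (w : Fin n → ℝ) (hw : ∑ i, w i = 1)
    (hpd : (Mmat A w).PosDef) :
    fmu A K Ψ μ (restr n w) = PhiHat K Ψ (Mmat A w) - μ * ∑ i, Real.log (w i) := by
  have h := sum_extendW n hn (restr n w) Real.log
  rw [extendW_restr n hn w hw] at h
  rw [h, fmu, extendW_restr n hn w hw, PhiHat_eq K hK Ψ hΨ hpd]
  ring

lemma log_bound (a b t : ℝ) (ha : 0 < a) (hb : 0 ≤ b) (ht0 : 0 < t) (ht1 : t < 1) :
    t * ((b - a) / ((1 - t) * a + t * b)) ≤ Real.log ((1 - t) * a + t * b) - Real.log a := by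
  have hp : 0 < (1 - t) * a + t * b := by
    have := mul_pos (sub_pos.2 ht1) ha
    have := mul_nonneg ht0.le hb
    linarith
  rw [← Real.log_div hp.ne' ha.ne']
  have h := Real.one_sub_inv_le_log_of_pos (div_pos hp ha)
  refine le_trans (le_of_eq ?_) h
  rw [inv_div, ← mul_div_assoc, eq_sub_iff_add_eq, ← add_div, div_eq_one_iff_eq hp.ne']
  ring

lemma key_ineq {n m k : ℕ} (hn : 1 ≤ n) (A : Fin n → Matrix (Fin m) (Fin m) ℝ)
    (hA : ∀ i, (A i).PosSemidef) (K : Matrix (Fin m) (Fin k) ℝ) (hK : K.rank = k)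
    (Ψ : Matrix (Fin k) (Fin k) ℝ → ℝ) (hΨ : Assumption1 k Ψ)
    (hall : ∀ w : Fin n → ℝ, (∀ i, 0 < w i) → (Mmat A w).PosDef)
    (μ C : ℝ) (hμ : 0 < μ) (v : Fin (n - 1) → ℝ) (hv : ∀ i, |v i| < C * μ)
    (w : Fin n → ℝ) (hw : ∀ i, 0 < w i) (hw1 : ∑ i, w i = 1)
    (hmin : ∀ wt' ∈ Dset n, fmu A K Ψ μ (restr n w) - ∑ i, v i * restr n w i ≤
        fmu A K Ψ μ wt' - ∑ i, v i * wt' i)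
    (w' : Fin n → ℝ) (hopt : IsOptimal A K Ψ w') (hC : 0 < C) :
    PhiHat K Ψ (Mmat A w) - fstar A K Ψ ≤ μ * (n + 2 * C) - μ * ∑ i, w' i / w i := by
  obtain ⟨⟨hw'0, hw'1⟩, hR, hf⟩ := hopt
  have hX := hall w hw
  have hY := Mmat_posSemidef A hA w' hw'0
  have hvb : ∑ i, v i * (restr n w i - restr n w' i) ≤ 2 * C * μ := by
    have h1 : ∀ i, v i * (restr n w i - restr n w' i) ≤
        C * μ * (restr n w i + restr n w' i) := by
      intro i
      have ha : 0 ≤ restr n w i := (hw _).le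
      have hb : 0 ≤ restr n w' i := hw'0 _
      have h3 := (abs_lt.mp (hv i))
      nlinarith
    refine (Finset.sum_le_sum fun i _ => h1 i).trans ?_
    rw [← Finset.mul_sum, Finset.sum_add_distrib]
    have h2 := sum_split n hn w
    have h3 := sum_split n hn w'
    have h4 := hw ⟨n - 1, by omega⟩
    have h5 := hw'0 ⟨n - 1, by omega⟩
    have h6 : ∑ i, restr n w i + ∑ i, restr n w' i ≤ 2 := by
      simp only [restr]; linarith
    have := mul_le_mul_of_nonneg_left h6 (mul_pos hC hμ).le
    linarith
  have hstep : ∀ t : ℝ, 0 < t → t < 1 →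
      PhiHat K Ψ (Mmat A w) - fstar A K Ψ ≤
        2 * C * μ - μ * ∑ i, (w' i - w i) / ((1 - t) * w i + t * w' i) := by
    intro t ht0 ht1
    have hpos : ∀ i, 0 < (1 - t) * w i + t * w' i := fun i => by
      have := mul_pos (sub_pos.2 ht1) (hw i)
      have := mul_nonneg ht0.le (hw'0 i)
      linarith
    have hsum : ∑ i, ((1 - t) * w i + t * w' i) = 1 := by
      rw [Finset.sum_add_distrib, ← Finset.mul_sum, ← Finset.mul_sum, hw1, hw'1]; ring
    have h1 := hmin _ (restr_Dset n hn _ hsum hpos)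
    rw [fmu_eq hn A K hK Ψ hΨ μ w hw1 hX, fmu_eq hn A K hK Ψ hΨ μ _ hsum (hall _ hpos),
      Mmat_comb] at h1
    have h2 := PhiHat_convex K hK Ψ hΨ hX hY hR t ht0 ht1
    rw [hf] at h2
    have h3 : ∑ i, v i * restr n (fun i => (1 - t) * w i + t * w' i) i
        = ∑ i, v i * restr n w i - t * ∑ i, v i * (restr n w i - restr n w' i) := by
      rw [Finset.mul_sum, ← Finset.sum_sub_distrib]
      refine Finset.sum_congr rfl fun i _ => ?_
      simp only [restr]; ring
    rw [h3] at h1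
    have h4 : t * ∑ i, (w' i - w i) / ((1 - t) * w i + t * w' i) ≤
        ∑ i, Real.log ((1 - t) * w i + t * w' i) - ∑ i, Real.log (w i) := by
      rw [Finset.mul_sum, ← Finset.sum_sub_distrib]
      exact Finset.sum_le_sum fun i _ => log_bound _ _ _ (hw i) (hw'0 i) ht0 ht1
    have h5 := mul_le_mul_of_nonneg_left h4 hμ.le
    have h6 := mul_le_mul_of_nonneg_left hvb ht0.le
    refine le_of_mul_le_mul_left ?_ ht0
    set Q := ∑ i, (w' i - w i) / ((1 - t) * w i + t * w' i)
    linarith [mul_left_comm μ t Q]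
  have hlim : Tendsto (fun t : ℝ => 2 * C * μ - μ * ∑ i, (w' i - w i) / ((1 - t) * w i + t * w' i))
      (𝓝[>] 0) (𝓝 (2 * C * μ - μ * ∑ i, (w' i - w i) / ((1 - 0) * w i + 0 * w' i))) := by
    apply tendsto_nhdsWithin_of_tendsto_nhds
    refine Tendsto.const_sub _ (Tendsto.const_mul _ (tendsto_finsetSum _ fun i _ => ?_))
    have hc : ContinuousAt (fun t : ℝ => (w' i - w i) / ((1 - t) * w i + t * w' i)) 0 := by
      refine ContinuousAt.div (by fun_prop) (by fun_prop) ?_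
      simpa using (hw i).ne'
    exact hc
  have hfin := ge_of_tendsto hlim (b := PhiHat K Ψ (Mmat A w) - fstar A K Ψ) (by
    filter_upwards [Ioo_mem_nhdsGT (zero_lt_one' ℝ)] with t ht
    exact hstep t ht.1 ht.2)
  refine hfin.trans (le_of_eq ?_)
  have : ∑ i, (w' i - w i) / ((1 - 0) * w i + 0 * w' i) = ∑ i, w' i / w i - n := by
    have : ∀ i, (w' i - w i) / ((1 - 0) * w i + 0 * w' i) = w' i / w i - 1 := by
      intro i
      have := (hw i).ne'
      rw [sub_zero, one_mul, zero_mul, add_zero, sub_div, div_self this]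
    simp only [this, Finset.sum_sub_distrib]
    simp
  rw [this]; ring

lemma tendsto_inv_mat {k : ℕ} {X : ℕ → Matrix (Fin k) (Fin k) ℝ} {Y : Matrix (Fin k) (Fin k) ℝ}
    (hY : Y.PosDef) (h : Tendsto X atTop (𝓝 Y)) : Tendsto (fun j => (X j)⁻¹) atTop (𝓝 Y⁻¹) := by
  have hd : Y.det ≠ 0 := hY.det_pos.ne'
  have h1 : ContinuousAt Ring.inverse Y.det := by
    rw [Ring.inverse_eq_inv']
    exact continuousAt_inv₀ hd
  exact (continuousAt_matrix_inv Y h1).tendsto.comp h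

lemma PhiHat_tendsto {n m k : ℕ} (A : Fin n → Matrix (Fin m) (Fin m) ℝ)
    (K : Matrix (Fin m) (Fin k) ℝ) (hK : K.rank = k)
    (Ψ : Matrix (Fin k) (Fin k) ℝ → ℝ) (hΨ : Assumption1 k Ψ)
    (W : ℕ → Fin n → ℝ) (w : Fin n → ℝ) (hW : ∀ j, (Mmat A (W j)).PosDef)
    (hw : (Mmat A w).PosDef) (h : Tendsto W atTop (𝓝 w)) :
    Tendsto (fun j => PhiHat K Ψ (Mmat A (W j))) atTop (𝓝 (PhiHat K Ψ (Mmat A w))) := by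
  simp only [PhiHat_eq K hK Ψ hΨ hw, fun j => PhiHat_eq K hK Ψ hΨ (hW j)]
  have h1 : Tendsto (fun j => Mmat A (W j)) atTop (𝓝 (Mmat A w)) := by
    have : Continuous (fun w : Fin n → ℝ => Mmat A w) := by
      unfold Mmat
      fun_prop
    exact this.continuousAt.tendsto.comp h
  have h2 := tendsto_inv_mat hw h1
  have h3 : Tendsto (fun j => Kᵀ * (Mmat A (W j))⁻¹ * K) atTop (𝓝 (Kᵀ * (Mmat A w)⁻¹ * K)) := by
    have : Continuous (fun X : Matrix (Fin m) (Fin m) ℝ => Kᵀ * X * K) := by fun_prop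
    exact this.continuousAt.tendsto.comp h2
  have h4 := tendsto_inv_mat (S_posDef K hK hw) h3
  have h5 := hΨ.smooth.continuousOn _ (S_posDef K hK hw).inv
  refine Tendsto.comp h5 (tendsto_nhdsWithin_iff.mpr ⟨h4, ?_⟩)
  exact Eventually.of_forall fun j => (S_posDef K hK (hW j)).inv

/-- Limits of central-path points along `‖v_j‖_∞ < C μ_j`, `μ_j → 0` are optimal solutions
of maximum cardinality. -/
theorem central_path_limit_max_cardinality (n m k : ℕ) (hn : 2 ≤ n) (hm : 1 ≤ m) (hk : 1 ≤ k) (hkm : k ≤ m)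
    (A : Fin n → Matrix (Fin m) (Fin m) ℝ) (hA : ∀ i, (A i).PosSemidef)
    (hex : ∃ w ∈ Omega n, (Mmat A w).PosDef)
    (K : Matrix (Fin m) (Fin k) ℝ) (hK : K.rank = k)
    (Ψ : Matrix (Fin k) (Fin k) ℝ → ℝ)
    (hΨ : Assumption1 k Ψ)
    (wfun : ℝ → (Fin (n - 1) → ℝ) → Fin (n - 1) → ℝ)
    (hwfun : ∀ μ : ℝ, 0 < μ → ∀ v : Fin (n - 1) → ℝ, wfun μ v ∈ Dset n ∧
      ∀ wt' ∈ Dset n, fmu A K Ψ μ (wfun μ v) - ∑ i, v i * wfun μ v i ≤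
        fmu A K Ψ μ wt' - ∑ i, v i * wt' i)
    (wstar : Fin n → ℝ) (hopt : IsOptimal A K Ψ wstar) (hpd : (Mmat A wstar).PosDef)
    (C : ℝ) (hC : 0 < C)
    (μs : ℕ → ℝ) (hμpos : ∀ j, 0 < μs j) (hμ0 : Tendsto μs atTop (𝓝 0))
    (vs : ℕ → Fin (n - 1) → ℝ) (hvs : ∀ j i, |vs j i| < C * μs j)
    (wdia : Fin n → ℝ)
    (hconv : Tendsto (fun j => extendW n (wfun (μs j) (vs j))) atTop (𝓝 wdia)) :
    IsOptimal A K Ψ wdia ∧ ∀ w' : Fin n → ℝ, IsOptimal A K Ψ w' →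
      (Finset.univ.filter fun i => 0 < w' i).card ≤
        (Finset.univ.filter fun i => 0 < wdia i).card := by
  have hn1 : 1 ≤ n := by omega
  have hall : ∀ w : Fin n → ℝ, (∀ i, 0 < w i) → (Mmat A w).PosDef := fun w hw =>
    Mmat_posDef_of_pos hn1 A hA wstar w hopt.1 hpd hw
  set W : ℕ → Fin n → ℝ := fun j => extendW n (wfun (μs j) (vs j)) with hWdef
  have hD : ∀ j, wfun (μs j) (vs j) ∈ Dset n := fun j => (hwfun _ (hμpos j) _).1
  have hWpos : ∀ j i, 0 < W j i := fun j i => extendW_pos n _ (hD j) i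
  have hWO : ∀ j, W j ∈ Omega n := fun j => extendW_Omega n hn1 _ (hD j)
  have hWpd : ∀ j, (Mmat A (W j)).PosDef := fun j => hall _ (hWpos j)
  have hWf : ∀ j, fstar A K Ψ ≤ PhiHat K Ψ (Mmat A (W j)) := fun j =>
    fstar_le A K Ψ hΨ _ (hWO j) (rangeIncl_of_posDef K (hWpd j))
  have hkey : ∀ w' : Fin n → ℝ, IsOptimal A K Ψ w' → ∀ j,
      PhiHat K Ψ (Mmat A (W j)) - fstar A K Ψ ≤
        μs j * (n + 2 * C) - μs j * ∑ i, w' i / W j i := by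
    intro w' hw' j
    refine key_ineq hn1 A hA K hK Ψ hΨ hall (μs j) C (hμpos j) (vs j) (hvs j) (W j) (hWpos j)
      (hWO j).2 ?_ w' hw' hC
    simp only [hWdef, restr_extendW]
    exact (hwfun _ (hμpos j) _).2
  have hNpos : (0 : ℝ) < n + 2 * C := by positivity
  have hlow : ∀ w' : Fin n → ℝ, IsOptimal A K Ψ w' → ∀ i,
      (n + 2 * C)⁻¹ * w' i ≤ wdia i := by
    intro w' hw' i
    refine ge_of_tendsto (tendsto_pi_nhds.mp hconv i) (Eventually.of_forall fun j => ?_)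
    have h1 := hkey w' hw' j
    have h2 := hWf j
    have h3 : ∑ i, w' i / W j i ≤ n + 2 * C := by
      refine le_of_mul_le_mul_left ?_ (hμpos j)
      linarith
    have h4 : w' i / W j i ≤ ∑ i, w' i / W j i :=
      Finset.single_le_sum (f := fun i => w' i / W j i)
        (fun l _ => div_nonneg (hw'.1.1 l) (hWpos j l).le) (Finset.mem_univ i)
    have h5 := h4.trans h3
    rw [div_le_iff₀ (hWpos j i)] at h5
    rwa [inv_mul_le_iff₀ hNpos]
  have hdpd : (Mmat A wdia).PosDef :=
    Mmat_posDef_of_ge A hA wstar wdia hpd _ (inv_pos.2 hNpos) (hlow wstar hopt)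
  have hdO : wdia ∈ Omega n := by
    refine ⟨fun i => ge_of_tendsto (tendsto_pi_nhds.mp hconv i)
      (Eventually.of_forall fun j => (hWpos j i).le), ?_⟩
    have h1 : Tendsto (fun j => ∑ i, W j i) atTop (𝓝 (∑ i, wdia i)) :=
      tendsto_finsetSum _ fun i _ => tendsto_pi_nhds.mp hconv i
    simp only [fun j => (hWO j).2] at h1
    exact (tendsto_nhds_unique h1 tendsto_const_nhds)
  have hdR := rangeIncl_of_posDef K hdpd
  refine ⟨⟨hdO, hdR, le_antisymm ?_ (fstar_le A K Ψ hΨ _ hdO hdR)⟩, ?_⟩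
  · have h1 := PhiHat_tendsto A K hK Ψ hΨ W wdia hWpd hdpd hconv
    have h2 : Tendsto (fun j => fstar A K Ψ + μs j * (n + 2 * C)) atTop
        (𝓝 (fstar A K Ψ + 0 * (n + 2 * C))) := (hμ0.mul_const _).const_add _
    have h3 := le_of_tendsto_of_tendsto' h1 h2 (fun j => by
      have h4 := hkey wstar hopt j
      have h5 : 0 ≤ μs j * ∑ i, wstar i / W j i := mul_nonneg (hμpos j).le
        (Finset.sum_nonneg fun l _ => div_nonneg (hopt.1.1 l) (hWpos j l).le)
      linarith)
    simpa using h3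
  · intro w' hw'
    refine Finset.card_le_card fun i hi => ?_
    simp only [Finset.mem_filter, Finset.mem_univ, true_and] at hi ⊢
    exact lt_of_lt_of_le (mul_pos (inv_pos.2 hNpos) hi) (hlow w' hw' i)
end
end

section
/- Suppose Ψ satisfies Assumption 1, the design problem has an optimal solution w* with M(w*) positive definite, and (w*, u*) solves the KKT system. Let B = {i : w*_i > 0} and N = {i : u*_i > 0}, and assume |B| + |N| = n. Assume further that for every w ∈ Ω with w_i > 0 for all i ∈ B and w_i = 0 for all i ∈ N, the B×B principal submatrix of the Hessian ∇²F(w) is positive definite. Then w(μ,v) converges as (μ,v) → (0,0) with μ > 0: there exists an optimal solution w⋄ of the design problem with maximum cardinality such that for every ε > 0 there is δ > 0 with ‖w(μ,v) − w⋄‖ < ε whenever 0 < μ < δ and ‖v‖ < δ. -/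
open Matrix Filter Topology

noncomputable section

attribute [local instance] Matrix.normedAddCommGroup Matrix.normedSpace

namespace CPath

lemma K_inj {m k : ℕ} {K : Matrix (Fin m) (Fin k) ℝ} (hK : K.rank = k) :
    Function.Injective K.mulVec := by
  have h : Module.finrank ℝ (LinearMap.range K.mulVecLin) = k := hK
  have h2 := LinearMap.finrank_range_add_finrank_ker K.mulVecLin
  rw [h, Module.finrank_fin_fun] at h2
  have h3 : Module.finrank ℝ (LinearMap.ker K.mulVecLin) = 0 := by omega
  have h4 := Submodule.finrank_eq_zero.mp h3
  have h5 := LinearMap.ker_eq_bot.mp h4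
  exact h5

/-- the information matrix -/
def CC {m k : ℕ} (K : Matrix (Fin m) (Fin k) ℝ) (M : Matrix (Fin m) (Fin m) ℝ) :
    Matrix (Fin k) (Fin k) ℝ := (Kᵀ * M⁻¹ * K)⁻¹

lemma inner_posDef {m k : ℕ} {K : Matrix (Fin m) (Fin k) ℝ} (hK : K.rank = k)
    {M : Matrix (Fin m) (Fin m) ℝ} (hM : M.PosDef) : (Kᵀ * M⁻¹ * K).PosDef := by
  have := hM.inv.conjTranspose_mul_mul_same (K_inj hK)
  rwa [Matrix.conjTranspose_eq_transpose_of_trivial] at this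

lemma CC_posDef {m k : ℕ} {K : Matrix (Fin m) (Fin k) ℝ} (hK : K.rank = k)
    {M : Matrix (Fin m) (Fin m) ℝ} (hM : M.PosDef) : (CC K M).PosDef :=
  (inner_posDef hK hM).inv

lemma schur {m k : ℕ} (K : Matrix (Fin m) (Fin k) ℝ)
    {M : Matrix (Fin m) (Fin m) ℝ} (hM : M.PosDef) {U : Matrix (Fin k) (Fin k) ℝ} (hU : U.PosDef) :
    (M - K * U * Kᵀ).PosSemidef ↔ (U⁻¹ - Kᵀ * M⁻¹ * K).PosSemidef := by
  have := hM.isUnit.invertible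
  have := hU.inv.isUnit.invertible
  have h1 := Matrix.PosDef.fromBlocks₁₁ K U⁻¹ hM
  have h2 := Matrix.PosDef.fromBlocks₂₂ M K hU.inv
  rw [Matrix.conjTranspose_eq_transpose_of_trivial] at h1 h2
  rw [Matrix.nonsing_inv_nonsing_inv _ ((Matrix.isUnit_iff_isUnit_det _).mp hU.isUnit)] at h2
  exact h2.symm.trans h1

lemma CC_feas {m k : ℕ} {K : Matrix (Fin m) (Fin k) ℝ} (hK : K.rank = k)
    {M : Matrix (Fin m) (Fin m) ℝ} (hM : M.PosDef) : (M - K * CC K M * Kᵀ).PosSemidef := by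
  rw [schur K hM (CC_posDef hK hM)]
  unfold CC
  rw [Matrix.nonsing_inv_nonsing_inv _
    ((Matrix.isUnit_iff_isUnit_det _).mp (inner_posDef hK hM).isUnit), sub_self]
  exact .zero

lemma CC_max {m k : ℕ} {K : Matrix (Fin m) (Fin k) ℝ} (hK : K.rank = k)
    {M : Matrix (Fin m) (Fin m) ℝ} (hM : M.PosDef) {U : Matrix (Fin k) (Fin k) ℝ} (hU : U.PosDef)
    (h : (M - K * U * Kᵀ).PosSemidef) : (CC K M - U).PosSemidef := by
  rw [schur K hM hU] at h
  have h2 := (schur (1 : Matrix (Fin k) (Fin k) ℝ) hU.inv (inner_posDef hK hM)).mp (by simpa using h)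
  rw [Matrix.nonsing_inv_nonsing_inv _ ((Matrix.isUnit_iff_isUnit_det _).mp hU.isUnit)] at h2
  simpa [CC] using h2

lemma CC_convex {m k : ℕ} {K : Matrix (Fin m) (Fin k) ℝ} (hK : K.rank = k)
    {Ψ : Matrix (Fin k) (Fin k) ℝ → ℝ} (hΨ : Assumption1 k Ψ)
    {M N : Matrix (Fin m) (Fin m) ℝ} {U V : Matrix (Fin k) (Fin k) ℝ} (hU : U.PosDef)
    (hV : V.PosDef) (h : (M - K * U * Kᵀ).PosSemidef) (h' : (N - K * V * Kᵀ).PosSemidef)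
    {t : ℝ} (ht : 0 < t) (ht1 : t < 1) (hMN : (t • M + (1 - t) • N).PosDef) :
    Ψ (CC K (t • M + (1 - t) • N)) ≤ t * Ψ U + (1 - t) * Ψ V := by
  have hs : 0 < 1 - t := by linarith
  have hUV : (t • U + (1 - t) • V).PosDef := (hU.smul ht).add (hV.smul hs)
  have hf : ((t • M + (1 - t) • N) - K * (t • U + (1 - t) • V) * Kᵀ).PosSemidef := by
    have := (h.smul ht.le).add (h'.smul hs.le)
    convert this using 1
    simp only [Matrix.mul_add, Matrix.add_mul, Matrix.mul_smul, Matrix.smul_mul, smul_sub]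
    abel
  refine (hΨ.decreasing _ _ (CC_posDef hK hMN).isHermitian hUV (CC_max hK hMN hUV hf)).trans ?_
  exact hΨ.convex U V hU hV t ht.le ht1.le

lemma psd_cs {m : ℕ} {M : Matrix (Fin m) (Fin m) ℝ} (hM : M.PosSemidef) (x y : Fin m → ℝ) :
    (y ⬝ᵥ M *ᵥ x) ^ 2 ≤ (y ⬝ᵥ M *ᵥ y) * (x ⬝ᵥ M *ᵥ x) := by
  have hsym : x ⬝ᵥ M *ᵥ y = y ⬝ᵥ M *ᵥ x := by
    have hT : Mᵀ = M := by
      have := hM.isHermitian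
      rwa [Matrix.IsHermitian, Matrix.conjTranspose_eq_transpose_of_trivial] at this
    rw [Matrix.dotProduct_mulVec, ← Matrix.mulVec_transpose, hT, dotProduct_comm]
  have key : ∀ t : ℝ, 0 ≤ (y ⬝ᵥ M *ᵥ y) * (t * t) + (2 * (y ⬝ᵥ M *ᵥ x)) * t + (x ⬝ᵥ M *ᵥ x) := by
    intro t
    have := hM.dotProduct_mulVec_nonneg (t • y + x)
    simp only [star_trivial, Matrix.mulVec_add, Matrix.mulVec_smul, add_dotProduct, dotProduct_add,
      smul_dotProduct, dotProduct_smul, smul_eq_mul, hsym] at this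
    nlinarith
  have := discrim_le_zero key
  unfold discrim at this
  nlinarith

lemma feas_nonempty {m k : ℕ} {K : Matrix (Fin m) (Fin k) ℝ}
    {M : Matrix (Fin m) (Fin m) ℝ} (hM : M.PosSemidef) (hR : RangeIncl K M) :
    ∃ U : Matrix (Fin k) (Fin k) ℝ, U.PosDef ∧ (M - K * U * Kᵀ).PosSemidef := by
  have hy : ∀ j : Fin k, ∃ y : Fin m → ℝ, M *ᵥ y = fun i => K i j := by
    intro j
    have : (Matrix.toLin' K) (Pi.single j 1) ∈ LinearMap.range (Matrix.toLin' M) :=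
      hR ⟨_, rfl⟩
    obtain ⟨y, hy⟩ := this
    refine ⟨y, ?_⟩
    rw [Matrix.toLin'_apply, Matrix.toLin'_apply, Matrix.mulVec_single_one] at hy
    exact hy
  choose Y hY using hy
  have hT : Mᵀ = M := by
    have := hM.isHermitian
    rwa [Matrix.IsHermitian, Matrix.conjTranspose_eq_transpose_of_trivial] at this
  set c : ℝ := ∑ j, (Y j ⬝ᵥ M *ᵥ Y j) with hc
  have hc0 : 0 ≤ c := Finset.sum_nonneg fun j _ => by
    simpa using hM.dotProduct_mulVec_nonneg (Y j)
  have he : 0 < (c + 1)⁻¹ := by positivity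
  refine ⟨(c + 1)⁻¹ • 1, Matrix.PosDef.one.smul he, ?_⟩
  have hKK : (K * Kᵀ).IsHermitian := by
    rw [Matrix.IsHermitian, Matrix.conjTranspose_eq_transpose_of_trivial]; simp
  have heq : M - K * ((c + 1)⁻¹ • (1 : Matrix (Fin k) (Fin k) ℝ)) * Kᵀ
      = M - (c + 1)⁻¹ • (K * Kᵀ) := by simp
  rw [heq]
  refine .of_dotProduct_mulVec_nonneg ?_ ?_
  · rw [Matrix.IsHermitian, Matrix.conjTranspose_eq_transpose_of_trivial]; simp [hT]
  intro x
  have h1 : x ⬝ᵥ (K * Kᵀ) *ᵥ x = ∑ j, (Y j ⬝ᵥ M *ᵥ x) ^ 2 := by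
    rw [← Matrix.mulVec_mulVec, Matrix.dotProduct_mulVec, ← Matrix.mulVec_transpose]
    unfold dotProduct
    refine Finset.sum_congr rfl fun j _ => ?_
    have : (Kᵀ *ᵥ x) j = Y j ⬝ᵥ M *ᵥ x := by
      rw [Matrix.dotProduct_mulVec, ← Matrix.mulVec_transpose, hT, hY]
      rfl
    rw [this]
    rw [sq]; rfl
  have h2 : x ⬝ᵥ (K * Kᵀ) *ᵥ x ≤ c * (x ⬝ᵥ M *ᵥ x) := by
    rw [h1, hc, Finset.sum_mul]
    exact Finset.sum_le_sum fun j _ => psd_cs hM x (Y j)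
  have h3 : 0 ≤ x ⬝ᵥ M *ᵥ x := by simpa using hM.dotProduct_mulVec_nonneg x
  simp only [star_trivial, Matrix.sub_mulVec, Matrix.smul_mulVec, dotProduct_sub, dotProduct_smul,
    smul_eq_mul]
  have h4 : (c + 1)⁻¹ * (x ⬝ᵥ (K * Kᵀ) *ᵥ x) ≤ (c + 1)⁻¹ * ((c + 1) * (x ⬝ᵥ M *ᵥ x)) := by
    apply mul_le_mul_of_nonneg_left _ he.le
    nlinarith
  rw [← mul_assoc, inv_mul_cancel₀ (by positivity), one_mul] at h4
  linarith

lemma PhiHat_eq {m k : ℕ} {K : Matrix (Fin m) (Fin k) ℝ} (hK : K.rank = k)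
    {Ψ : Matrix (Fin k) (Fin k) ℝ → ℝ} (hΨ : Assumption1 k Ψ)
    {M : Matrix (Fin m) (Fin m) ℝ} (hM : M.PosDef) : PhiHat K Ψ M = Ψ (CC K M) := by
  refine IsLeast.csInf_eq ⟨⟨CC K M, CC_posDef hK hM, CC_feas hK hM, rfl⟩, ?_⟩
  rintro y ⟨U, hU, h, rfl⟩
  exact hΨ.decreasing _ _ (CC_posDef hK hM).isHermitian hU (CC_max hK hM hU h)

lemma Mmat_comb {n m : ℕ} (A : Fin n → Matrix (Fin m) (Fin m) ℝ) (a b : ℝ) (w z : Fin n → ℝ) :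
    Mmat A (a • w + b • z) = a • Mmat A w + b • Mmat A z := by
  simp [Mmat, Finset.smul_sum, add_smul, mul_smul, Finset.sum_add_distrib]

lemma Mmat_psd {n m : ℕ} {A : Fin n → Matrix (Fin m) (Fin m) ℝ} (hA : ∀ i, (A i).PosSemidef)
    {w : Fin n → ℝ} (hw : ∀ i, 0 ≤ w i) : (Mmat A w).PosSemidef :=
  Matrix.posSemidef_sum _ fun i _ => (hA i).smul (hw i)

lemma Mmat_pd_comb {n m : ℕ} {A : Fin n → Matrix (Fin m) (Fin m) ℝ} (hA : ∀ i, (A i).PosSemidef)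
    {w z : Fin n → ℝ} (hw : ∀ i, 0 ≤ w i) (hz : (Mmat A z).PosDef) {a b : ℝ} (ha : 0 ≤ a)
    (hb : 0 < b) : (Mmat A (a • w + b • z)).PosDef := by
  rw [Mmat_comb]
  exact Matrix.PosDef.posSemidef_add ((Mmat_psd hA hw).smul ha) (hz.smul hb)

lemma Mmat_pd_pos {n m : ℕ} {A : Fin n → Matrix (Fin m) (Fin m) ℝ} (hA : ∀ i, (A i).PosSemidef)
    {w z : Fin n → ℝ} (hw : ∀ i, 0 < w i) (hz0 : ∀ i, z i ≤ 1)
    (hz : (Mmat A z).PosDef) : (Mmat A w).PosDef := by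
  obtain ⟨c, hc, hcw⟩ : ∃ c : ℝ, 0 < c ∧ ∀ i, c ≤ w i := by
    rcases isEmpty_or_nonempty (Fin n) with h | h
    · exact ⟨1, one_pos, fun i => (h.false i).elim⟩
    · obtain ⟨i, hi⟩ := Finite.exists_min w
      exact ⟨w i, hw i, hi⟩
  have : w = (1 : ℝ) • (w - c • z) + c • z := by simp
  rw [this]
  refine Mmat_pd_comb hA (fun i => ?_) hz zero_le_one hc
  have := hcw i
  have := hz0 i
  simp only [Pi.sub_apply, Pi.smul_apply, smul_eq_mul]
  nlinarith

end CPath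

namespace CPath

lemma strict_min {n : ℕ} (F : (Fin n → ℝ) → ℝ) (g : (Fin n → ℝ) → Fin n → ℝ)
    (H : Matrix (Fin n) (Fin n) ℝ) (z u w : Fin n → ℝ)
    (hF : ∀ t : ℝ, 0 ≤ t → t ≤ 1 / 2 → HasFDerivAt F
      (∑ i, g (z + t • (w - z)) i •
        ContinuousLinearMap.proj (R := ℝ) (φ := fun _ : Fin n => ℝ) i) (z + t • (w - z)))
    (hH : ∀ j, HasFDerivAt (fun x => g x j)
        (∑ i, H i j • ContinuousLinearMap.proj (R := ℝ) (φ := fun _ : Fin n => ℝ) i) z)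
    (hle : ∀ t : ℝ, 0 < t → t ≤ 1 / 2 → F (z + t • (w - z)) ≤ F z)
    (hz : z ∈ Omega n) (hw : w ∈ Omega n)
    (hu0 : ∀ i, 0 ≤ u i) (hcomp : ∀ i, u i * z i = 0)
    (hlam : ∃ lam : ℝ, ∀ i, g z i - u i = lam)
    (hcov : ∀ i, 0 < z i ∨ 0 < u i)
    (hpos : (H.submatrix (fun p : {i : Fin n // 0 < z i} => (p : Fin n))
        (fun p : {i : Fin n // 0 < z i} => (p : Fin n))).PosDef) : w = z := by
  by_contra hne
  set d : Fin n → ℝ := w - z with hd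
  have hline : ∀ t : ℝ, HasDerivAt (fun s : ℝ => z + s • d) d t := by
    intro t
    simpa using ((hasDerivAt_id t).smul_const d).const_add z
  -- derivative of F along the line
  have hφ : ∀ t : ℝ, 0 ≤ t → t ≤ 1 / 2 →
      HasDerivAt (fun s : ℝ => F (z + s • d)) (∑ i, g (z + t • d) i * d i) t := by
    intro t h0 h1
    have := (hF t h0 h1).comp_hasDerivAt t (hline t)
    simpa [Function.comp_def] using this
  have hψ : HasDerivAt (fun s : ℝ => ∑ j, g (z + s • d) j * d j)
      (∑ j, (∑ i, H i j * d i) * d j) 0 := by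
    refine HasDerivAt.fun_sum fun j _ => ?_
    have h0 : HasFDerivAt (fun x => g x j)
        (∑ i, H i j • ContinuousLinearMap.proj (R := ℝ) (φ := fun _ : Fin n => ℝ) i)
        (z + (0 : ℝ) • d) := by simpa using hH j
    have := (h0.comp_hasDerivAt (0 : ℝ) (hline 0)).mul_const (d j)
    simpa [Function.comp_def] using this
  -- value at zero
  have hval : ∑ i, g z i * d i = ∑ i, u i * w i := by
    obtain ⟨lam, hl⟩ := hlam
    have h1 : ∀ i, g z i * d i = lam * w i - lam * z i + u i * w i := by
      intro i
      have h2 : g z i = lam + u i := by linarith [hl i]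
      have h3 := hcomp i
      rw [h2, hd]
      simp only [Pi.sub_apply]
      linear_combination -h3
    simp only [h1, Finset.sum_add_distrib, Finset.sum_sub_distrib, ← Finset.mul_sum, hz.2, hw.2]
    ring
  have hnn : ∀ i, 0 ≤ u i * w i := fun i => mul_nonneg (hu0 i) (hw.1 i)
  have hle0 : ∑ i, u i * w i ≤ 0 := by
    have h0 := hφ 0 le_rfl (by norm_num)
    simp only [zero_smul, add_zero, hval] at h0
    by_contra hc
    push Not at hc
    have hs := h0.hasDerivWithinAt (s := Set.Ioi 0)
    have ev := (hasDerivWithinAt_iff_tendsto_slope' (by simp)).mp hs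
    have ev1 := ev.eventually (lt_mem_nhds hc)
    have ev2 : ∀ᶠ t : ℝ in 𝓝[>] 0, t < 1 / 2 :=
      nhdsWithin_le_nhds (gt_mem_nhds (by norm_num))
    obtain ⟨t, ⟨ht1, ht2⟩, ht3⟩ := ((ev1.and ev2).and self_mem_nhdsWithin).exists
    have ht3 : 0 < t := ht3
    have := hle t ht3 ht2.le
    rw [slope_def_field] at ht1
    simp only [zero_smul, add_zero, sub_zero] at ht1
    have h5 : (F (z + t • d) - F z) / t ≤ 0 := div_nonpos_of_nonpos_of_nonneg (by linarith) ht3.le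
    linarith
  have huw : ∀ i, u i * w i = 0 := by
    have h1 : ∑ i, u i * w i = 0 := le_antisymm hle0 (Finset.sum_nonneg fun i _ => hnn i)
    intro i
    exact (Finset.sum_eq_zero_iff_of_nonneg (fun i _ => hnn i)).mp h1 i (Finset.mem_univ i)
  have hdN : ∀ i, ¬ 0 < z i → d i = 0 := by
    intro i hi
    have h1 : 0 < u i := (hcov i).resolve_left hi
    have h2 : w i = 0 := (mul_eq_zero.mp (huw i)).resolve_left h1.ne'
    have h3 : z i = 0 := (mul_eq_zero.mp (hcomp i)).resolve_left h1.ne'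
    simp [hd, h2, h3]
  have hqpos : 0 < ∑ j, (∑ i, H i j * d i) * d j := by
    have hx : (fun p : {i : Fin n // 0 < z i} => d p) ≠ 0 := by
      intro h
      apply hne
      have : d = 0 := by
        funext i
        by_cases hi : 0 < z i
        · exact congrFun h ⟨i, hi⟩
        · exact hdN i hi
      rw [hd] at this
      exact sub_eq_zero.mp this
    have h1 := hpos.dotProduct_mulVec_pos hx
    have hsub : ∀ f : Fin n → ℝ, (∀ i, ¬ 0 < z i → f i = 0) →
        ∑ p : {i : Fin n // 0 < z i}, f p = ∑ i, f i := by
      intro f hf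
      rw [← Finset.sum_subtype (Finset.univ.filter fun i => 0 < z i) (by simp) f]
      rw [Finset.sum_filter_of_ne]
      intro i _ hi
      by_contra h
      exact hi (hf i h)
    have h2 : star (fun p : {i : Fin n // 0 < z i} => d p) ⬝ᵥ
        (H.submatrix (fun p : {i : Fin n // 0 < z i} => (p : Fin n))
        (fun p : {i : Fin n // 0 < z i} => (p : Fin n))) *ᵥ
          (fun p : {i : Fin n // 0 < z i} => d p) = ∑ i, d i * ∑ j, H i j * d j := by
      simp only [star_trivial, dotProduct, Matrix.mulVec, Matrix.submatrix_apply]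
      rw [← hsub (fun i => d i * ∑ j, H i j * d j) (fun i hi => by simp [hdN i hi])]
      refine Finset.sum_congr rfl fun p _ => ?_
      rw [hsub (fun j => H p j * d j) (fun i hi => by simp [hdN i hi])]
    rw [h2] at h1
    refine h1.trans_eq ?_
    simp only [Finset.sum_mul, Finset.mul_sum]
    rw [Finset.sum_comm]
    refine Finset.sum_congr rfl fun i _ => Finset.sum_congr rfl fun j _ => by ring
  -- positivity of the derivative near zero
  have hs := hψ.hasDerivWithinAt (s := Set.Ioi 0)
  have ev := (hasDerivWithinAt_iff_tendsto_slope' (by simp)).mp hs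
  have ev1 := ev.eventually (lt_mem_nhds hqpos)
  obtain ⟨r, hr, hrr⟩ := mem_nhdsGT_iff_exists_Ioo_subset.mp ev1
  have hr : 0 < r := hr
  set s := min r (1 / 2) with hsdef
  have hs0 : 0 < s := lt_min hr (by norm_num)
  obtain ⟨c, hc, hceq⟩ := exists_hasDerivAt_eq_slope (fun s : ℝ => F (z + s • d))
    (fun t => ∑ i, g (z + t • d) i * d i) hs0
    (fun t ht => (hφ t ht.1 (ht.2.trans (min_le_right _ _))).continuousAt.continuousWithinAt)
    (fun t ht => hφ t ht.1.le (ht.2.le.trans (min_le_right _ _)))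
  have hcp : 0 < slope (fun s : ℝ => ∑ j, g (z + s • d) j * d j) 0 c :=
    hrr ⟨hc.1, hc.2.trans_le (min_le_left _ _)⟩
  rw [slope_def_field] at hcp
  have hsum0 : ∑ i, u i * w i = 0 := by simp [huw]
  simp only [zero_smul, add_zero, sub_zero, hval, hsum0] at hcp hceq
  rw [hceq] at hcp
  have h6 := hle s hs0 (min_le_right _ _)
  have h7 : (F (z + s • d) - F z) / s ≤ 0 := div_nonpos_of_nonpos_of_nonneg (by linarith) hs0.le
  have h8 := div_nonpos_of_nonpos_of_nonneg h7 hc.1.le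
  linarith

lemma extend_castPred {n : ℕ} (wt : Fin n → ℝ) :
    extendW (n + 1) wt = Fin.snoc (α := fun _ => ℝ) wt (1 - ∑ j, wt j) := by
  funext i
  refine Fin.lastCases ?_ (fun j => ?_) i
  · simp [extendW]
  · simp [extendW]

lemma extend_props {n : ℕ} (hn : 2 ≤ n) {wt : Fin (n - 1) → ℝ} (h : wt ∈ Dset n) :
    (∀ i, 0 < extendW n wt i) ∧ extendW n wt ∈ Omega n := by
  obtain ⟨n, rfl⟩ : ∃ l, n = l + 1 := ⟨n - 1, by omega⟩
  have hpos : ∀ i, 0 < extendW (n + 1) wt i := by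
    intro i
    unfold extendW
    split_ifs with h1
    · exact h.1 _
    · exact sub_pos.mpr h.2
  refine ⟨hpos, fun i => (hpos i).le, ?_⟩
  have := extend_castPred (n := n) wt
  rw [this, Fin.sum_univ_castSucc]
  simp

lemma exists_extend {n : ℕ} (hn : 2 ≤ n) {w : Fin n → ℝ} (hpos : ∀ i, 0 < w i)
    (h : w ∈ Omega n) : ∃ wt ∈ Dset n, extendW n wt = w := by
  obtain ⟨n, rfl⟩ : ∃ l, n = l + 1 := ⟨n - 1, by omega⟩
  have hs := h.2
  rw [Fin.sum_univ_castSucc] at hs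
  refine ⟨fun i : Fin n => w i.castSucc, ⟨fun i => hpos _, ?_⟩, ?_⟩
  · have := hpos (Fin.last n)
    change ∑ i : Fin n, w i.castSucc < 1
    linarith
  · have := extend_castPred (n := n) (fun i : Fin n => w i.castSucc)
    refine this.trans ?_
    funext i
    refine Fin.lastCases ?_ (fun j => ?_) i
    · simp; linarith
    · simp

/-- log terms are bounded. -/
lemma D_le_one {n : ℕ} {wt : Fin (n - 1) → ℝ} (h : wt ∈ Dset n) (i) : wt i ≤ 1 :=
  (Finset.single_le_sum (fun j _ => (h.1 j).le) (Finset.mem_univ i)).trans h.2.le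

lemma barrier_nonneg {n : ℕ} {wt : Fin (n - 1) → ℝ} (h : wt ∈ Dset n) :
    0 ≤ - (∑ i, Real.log (wt i)) - Real.log (1 - ∑ i, wt i) := by
  have h1 : ∑ i, Real.log (wt i) ≤ 0 :=
    Finset.sum_nonpos fun i _ => Real.log_nonpos (h.1 i).le (D_le_one h i)
  have h2 : Real.log (1 - ∑ i, wt i) ≤ 0 :=
    Real.log_nonpos (sub_pos.mpr h.2).le
      (by linarith [Finset.sum_nonneg (s := Finset.univ) fun i _ => (h.1 i).le])
  linarith

lemma lin_bound {n : ℕ} {wt : Fin (n - 1) → ℝ} (h : wt ∈ Dset n) (v : Fin (n - 1) → ℝ) :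
    |∑ i, v i * wt i| ≤ ‖v‖ := by
  calc |∑ i, v i * wt i| ≤ ∑ i, |v i * wt i| := Finset.abs_sum_le_sum_abs _ _
    _ ≤ ∑ i, ‖v‖ * wt i := Finset.sum_le_sum fun i _ => by
        rw [abs_mul, abs_of_pos (h.1 i)]
        exact mul_le_mul_of_nonneg_right (norm_le_pi_norm v i) (h.1 i).le
    _ = ‖v‖ * ∑ i, wt i := by rw [Finset.mul_sum]
    _ ≤ ‖v‖ := by nlinarith [norm_nonneg v, h.2]

lemma Omega_le_one {n : ℕ} {w : Fin n → ℝ} (h : w ∈ Omega n) (i) : w i ≤ 1 :=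
  h.2 ▸ Finset.single_le_sum (fun j _ => h.1 j) (Finset.mem_univ i)

lemma Omega_compact (n : ℕ) : IsCompact (Omega n) := by
  have : Omega n = stdSimplex ℝ (Fin n) := rfl
  rw [this]
  exact isCompact_stdSimplex ℝ (Fin n)

end CPath

/-- Under strict complementarity and positive definiteness of the reduced Hessian,
the central path `w(μ, v)` converges, as `(μ, v) → (0₊, 0)`, to an optimal solution of
maximum cardinality. -/
theorem central_path_full_convergence (n m k : ℕ) (hn : 2 ≤ n) (hm : 1 ≤ m) (hk : 1 ≤ k) (hkm : k ≤ m)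
    (A : Fin n → Matrix (Fin m) (Fin m) ℝ) (hA : ∀ i, (A i).PosSemidef)
    (hex : ∃ w ∈ Omega n, (Mmat A w).PosDef)
    (K : Matrix (Fin m) (Fin k) ℝ) (hK : K.rank = k)
    (Ψ : Matrix (Fin k) (Fin k) ℝ → ℝ)
    (hΨ : Assumption1 k Ψ)
    (wfun : ℝ → (Fin (n - 1) → ℝ) → Fin (n - 1) → ℝ)
    (hwfun : ∀ μ : ℝ, 0 < μ → ∀ v : Fin (n - 1) → ℝ, wfun μ v ∈ Dset n ∧
      ∀ wt' ∈ Dset n, fmu A K Ψ μ (wfun μ v) - ∑ i, v i * wfun μ v i ≤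
        fmu A K Ψ μ wt' - ∑ i, v i * wt' i)
    (g : (Fin n → ℝ) → Fin n → ℝ)
    (hg : ∀ w : Fin n → ℝ, (Mmat A w).PosDef →
      HasFDerivAt (fun z => Ψ ((Kᵀ * (Mmat A z)⁻¹ * K)⁻¹))
        (∑ i, g w i • ContinuousLinearMap.proj (R := ℝ) (φ := fun _ : Fin n => ℝ) i) w)
    (Hess : (Fin n → ℝ) → Matrix (Fin n) (Fin n) ℝ)
    (hHess : ∀ w : Fin n → ℝ, (Mmat A w).PosDef → ∀ j,
      HasFDerivAt (fun z => g z j)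
        (∑ i, Hess w i j • ContinuousLinearMap.proj (R := ℝ) (φ := fun _ : Fin n => ℝ) i) w)
    (wstar ustar : Fin n → ℝ)
    (hopt : IsOptimal A K Ψ wstar) (hpd : (Mmat A wstar).PosDef)
    (hu0 : ∀ i, 0 ≤ ustar i) (hcomp : ∀ i, ustar i * wstar i = 0)
    (hlam : ∃ lam : ℝ, ∀ i, g wstar i - ustar i = lam)
    (hcard : (Finset.univ.filter fun i => 0 < wstar i).card +
      (Finset.univ.filter fun i => 0 < ustar i).card = n)
    (hHpos : ∀ w ∈ Omega n, (∀ i, 0 < wstar i → 0 < w i) → (∀ i, 0 < ustar i → w i = 0) →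
      ((Hess w).submatrix (fun p : {i : Fin n // 0 < wstar i} => (p : Fin n))
        (fun p : {i : Fin n // 0 < wstar i} => (p : Fin n))).PosDef) :
    ∃ wdia : Fin n → ℝ,
      (IsOptimal A K Ψ wdia ∧ ∀ w' : Fin n → ℝ, IsOptimal A K Ψ w' →
        (Finset.univ.filter fun i => 0 < w' i).card ≤
          (Finset.univ.filter fun i => 0 < wdia i).card) ∧
      ∀ ε : ℝ, 0 < ε → ∃ δ : ℝ, 0 < δ ∧
        ∀ (μ : ℝ) (v : Fin (n - 1) → ℝ), 0 < μ → μ < δ → ‖v‖ < δ →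
          ‖extendW n (wfun μ v) - wdia‖ < ε := by
  classical
  set F : (Fin n → ℝ) → ℝ := fun z => Ψ (CPath.CC K (Mmat A z)) with hFdef
  have hF : ∀ w, (Mmat A w).PosDef → HasFDerivAt F
      (∑ i, g w i • ContinuousLinearMap.proj (R := ℝ) (φ := fun _ : Fin n => ℝ) i) w := hg
  have hΩ := hopt.1
  have hfs : fstar A K Ψ = F wstar := hopt.2.2.symm.trans (CPath.PhiHat_eq hK hΨ hpd)
  -- convexity towards the optimum
  have hcvx : ∀ w : Fin n → ℝ, (Mmat A w).PosDef → ∀ t : ℝ, 0 < t → t < 1 →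
      F (t • w + (1 - t) • wstar) ≤ t * F w + (1 - t) * F wstar := by
    intro w hw t h0 h1
    have hP : (t • Mmat A w + (1 - t) • Mmat A wstar).PosDef :=
      (hw.smul h0).add (hpd.smul (by linarith))
    have := CPath.CC_convex hK hΨ (CPath.CC_posDef hK hw) (CPath.CC_posDef hK hpd)
      (CPath.CC_feas hK hw) (CPath.CC_feas hK hpd) h0 h1 hP
    simpa only [hFdef, CPath.Mmat_comb] using this
  have hcov : ∀ i, 0 < wstar i ∨ 0 < ustar i := by
    have hdisj : Disjoint (Finset.univ.filter fun i => 0 < wstar i)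
        (Finset.univ.filter fun i => 0 < ustar i) := by
      rw [Finset.disjoint_filter]
      intro i _ h1 h2
      exact (mul_pos h2 h1).ne' (hcomp i)
    have hc := Finset.card_union_of_disjoint hdisj
    rw [hcard] at hc
    have hu := (Finset.card_eq_iff_eq_univ _).mp (hc.trans (Fintype.card_fin n).symm)
    intro i
    have := Finset.mem_univ i
    rw [← hu] at this
    simpa using this
  have hposH := hHpos wstar hΩ (fun i h => h) (fun i h =>
    (mul_eq_zero.mp (hcomp i)).resolve_left h.ne')
  set mid : (Fin n → ℝ) → Fin n → ℝ := fun w => (1 / 2 : ℝ) • w + (1 / 2 : ℝ) • wstar with hmid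
  have hmidpd : ∀ w ∈ Omega n, (Mmat A (mid w)).PosDef := fun w hw =>
    CPath.Mmat_pd_comb hA hw.1 hpd (by norm_num) (by norm_num)
  have huniq : ∀ w ∈ Omega n, F (mid w) ≤ F wstar → w = wstar := by
    intro w hw hle
    refine CPath.strict_min F g (Hess wstar) wstar ustar w ?_ (hHess wstar hpd) ?_ hΩ hw hu0 hcomp
      hlam hcov hposH
    · intro t h0 h1
      apply hF
      have : wstar + t • (w - wstar) = t • w + (1 - t) • wstar := by
        rw [smul_sub, sub_smul, one_smul]; abel
      rw [this]
      exact CPath.Mmat_pd_comb hA hw.1 hpd h0 (by linarith)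
    · intro t h0 h1
      rcases h1.eq_or_lt with h1 | h1
      · have : wstar + t • (w - wstar) = mid w := by
          rw [h1, hmid]; ext i; simp; ring
        rw [this]; exact hle
      · have : wstar + t • (w - wstar) = (2 * t) • mid w + (1 - 2 * t) • wstar := by
          rw [hmid]; ext i; simp; ring
        rw [this]
        refine (hcvx (mid w) (hmidpd w hw) (2 * t) (by linarith) (by linarith)).trans ?_
        nlinarith
  have honly : ∀ w', IsOptimal A K Ψ w' → w' = wstar := by
    intro w' h
    apply huniq w' h.1
    refine le_of_forall_pos_le_add fun ε hε => ?_
    obtain ⟨U0, hU0, hU0f⟩ := CPath.feas_nonempty (CPath.Mmat_psd hA h.1.1) h.2.1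
    have hlt : PhiHat K Ψ (Mmat A w') < F wstar + ε := by
      rw [h.2.2, hfs]; linarith
    obtain ⟨y, ⟨U, hU, hUf, rfl⟩, hy⟩ := exists_lt_of_csInf_lt (s := {y | ∃ U : Matrix (Fin k) (Fin k) ℝ,
      U.PosDef ∧ (Mmat A w' - K * U * Kᵀ).PosSemidef ∧ y = Ψ U}) ⟨_, U0, hU0, hU0f, rfl⟩ hlt
    have hP : ((1 / 2 : ℝ) • Mmat A w' + (1 - 1 / 2 : ℝ) • Mmat A wstar).PosDef := by
      have := hmidpd w' h.1
      rw [hmid, CPath.Mmat_comb] at this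
      convert this using 3
      norm_num
    have h1 := CPath.CC_convex hK hΨ hU (CPath.CC_posDef hK hpd) hUf (CPath.CC_feas hK hpd)
      (by norm_num) (by norm_num) hP
    have h2 : F (mid w') = Ψ (CPath.CC K ((1 / 2 : ℝ) • Mmat A w' + (1 - 1 / 2 : ℝ) • Mmat A wstar)) := by
      rw [hFdef, hmid]
      simp only [CPath.Mmat_comb]
      norm_num
    have h3 : F wstar = Ψ (CPath.CC K (Mmat A wstar)) := rfl
    rw [h2]
    linarith
  refine ⟨wstar, ⟨hopt, fun w' h => by rw [honly w' h]⟩, ?_⟩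
  intro ε hε
  -- growth
  obtain ⟨η, hη, hgrow⟩ : ∃ η : ℝ, 0 < η ∧ ∀ w ∈ Omega n, (Mmat A w).PosDef → ε ≤ ‖w - wstar‖ →
      F wstar + η ≤ F w := by
    set S : Set (Fin n → ℝ) := Omega n ∩ {w | ε ≤ ‖w - wstar‖} with hS
    have hScomp : IsCompact S := (CPath.Omega_compact n).inter_right
      (isClosed_le continuous_const (by fun_prop))
    have hcont : ContinuousOn (fun w => F (mid w)) S := by
      intro w hw
      have h1 : ContinuousAt F (mid w) := (hF _ (hmidpd w hw.1)).continuousAt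
      have h2 : ContinuousAt mid w := by
        have : Continuous mid := by rw [hmid]; fun_prop
        exact this.continuousAt
      exact (ContinuousAt.comp (f := mid) (g := F) h1 h2).continuousWithinAt
    rcases S.eq_empty_or_nonempty with hE | hne
    · refine ⟨1, one_pos, fun w hw _ hwε => ?_⟩
      have : w ∈ S := ⟨hw, hwε⟩
      rw [hE] at this
      exact this.elim
    · obtain ⟨w0, hw0, hmin⟩ := hScomp.exists_isMinOn hne hcont
      have hlt : F wstar < F (mid w0) := by
        by_contra hc
        push Not at hc
        have h1 := huniq w0 hw0.1 hc
        have h2 : ε ≤ ‖w0 - wstar‖ := hw0.2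
        rw [h1, sub_self, norm_zero] at h2
        linarith
      refine ⟨F (mid w0) - F wstar, by linarith, fun w hw hwp hwε => ?_⟩
      have h1 : F (mid w0) ≤ F (mid w) := hmin ⟨hw, hwε⟩
      have h2 := hcvx w hwp (1 / 2) (by norm_num) (by norm_num)
      have h3 : (1 / 2 : ℝ) • w + (1 - 1 / 2 : ℝ) • wstar = mid w := by rw [hmid]; norm_num
      rw [h3] at h2
      linarith
  -- interior competitor
  obtain ⟨wt, hwt, hwtF⟩ : ∃ wt ∈ Dset n, F (extendW n wt) < F wstar + η / 2 := by
    have hn0 : (0 : ℝ) < n := by exact_mod_cast (by omega : 0 < n)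
    set b : Fin n → ℝ := fun _ => (n : ℝ)⁻¹ with hb
    have hcont : ContinuousAt (fun s : ℝ => F (s • b + (1 - s) • wstar)) 0 := by
      have h1 : ContinuousAt F ((0 : ℝ) • b + (1 - (0 : ℝ)) • wstar) := by
        simpa using (hF wstar hpd).continuousAt
      have h2 : ContinuousAt (fun s : ℝ => s • b + (1 - s) • wstar) 0 := by fun_prop
      exact ContinuousAt.comp (f := fun s : ℝ => s • b + (1 - s) • wstar) (g := F) h1 h2
    have hlt : (fun s : ℝ => F (s • b + (1 - s) • wstar)) 0 < F wstar + η / 2 := by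
      simp; linarith
    have ev1 : ∀ᶠ s : ℝ in 𝓝[>] 0, F (s • b + (1 - s) • wstar) < F wstar + η / 2 :=
      nhdsWithin_le_nhds (hcont.eventually (gt_mem_nhds hlt))
    have ev2 : ∀ᶠ t : ℝ in 𝓝[>] 0, t < 1 := nhdsWithin_le_nhds (gt_mem_nhds (by norm_num))
    obtain ⟨s, ⟨hs1, hs2⟩, hs3⟩ := ((ev1.and ev2).and self_mem_nhdsWithin).exists
    have hs3 : 0 < s := hs3
    have hp : ∀ i, 0 < (s • b + (1 - s) • wstar) i := by
      intro i
      have := hΩ.1 i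
      simp only [Pi.add_apply, Pi.smul_apply, smul_eq_mul, hb]
      have h1 : 0 < s * (n : ℝ)⁻¹ := by positivity
      have h2 : 0 ≤ (1 - s) * wstar i := mul_nonneg (by linarith) this
      linarith
    obtain ⟨wt, h1, h2⟩ := CPath.exists_extend hn hp ⟨fun i => (hp i).le, by
      simp only [Pi.add_apply, Pi.smul_apply, smul_eq_mul, Finset.sum_add_distrib,
        ← Finset.mul_sum, hΩ.2, hb, Finset.sum_const, Finset.card_univ, Fintype.card_fin,
        nsmul_eq_mul, mul_inv_cancel₀ hn0.ne']
      ring⟩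
    exact ⟨wt, h1, by rw [h2]; exact hs1⟩
  set L : ℝ := - (∑ i, Real.log (wt i)) - Real.log (1 - ∑ i, wt i) with hL
  have hL0 : 0 ≤ L := CPath.barrier_nonneg hwt
  refine ⟨η / 2 / (L + 2), by positivity, ?_⟩
  intro μ v hμ hμδ hvδ
  obtain ⟨hD, hmin⟩ := hwfun μ hμ v
  obtain ⟨hep, heΩ⟩ := CPath.extend_props hn hD
  have hepd : (Mmat A (extendW n (wfun μ v))).PosDef :=
    CPath.Mmat_pd_pos hA hep (CPath.Omega_le_one hΩ) hpd
  by_contra hc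
  push Not at hc
  have h1 := hgrow _ heΩ hepd hc
  have h2 := hmin wt hwt
  have hfmu : ∀ x, fmu A K Ψ μ x = F (extendW n x)
      + μ * (- (∑ i, Real.log (x i)) - Real.log (1 - ∑ i, x i)) := by
    intro x
    simp only [fmu, hFdef, CPath.CC]
    ring
  rw [hfmu, hfmu, ← hL] at h2
  have h3 := mul_nonneg hμ.le (CPath.barrier_nonneg hD)
  have h4 := abs_le.mp (CPath.lin_bound hD v)
  have h5 := abs_le.mp (CPath.lin_bound hwt v)
  rw [lt_div_iff₀ (by positivity)] at hμδ hvδ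
  have h6 : μ * L + 2 * ‖v‖ ≤ max μ ‖v‖ * (L + 2) := by
    have := le_max_left μ ‖v‖
    have := le_max_right μ ‖v‖
    nlinarith
  have h7 : max μ ‖v‖ * (L + 2) < η / 2 := by
    rcases max_cases μ ‖v‖ with h | h <;> rw [h.1] <;> assumption
  linarith [h4.1, h4.2, h5.1, h5.2]
end
end

section
/- Let p < 0 and define Φ_p(X) = tr((K^T X^{-1} K)^{-p}) for m×m real symmetric positive definite X, where the matrix power is taken via the spectral decomposition of the positive definite matrix K^T X^{-1} K. Then Φ_p is differentiable at every positive definite X, and its derivative in any direction H ∈ S^m is DΦ_p(X)[H] = p · tr(X^{-1} K (K^T X^{-1} K)^{-p-1} K^T X^{-1} H). -/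
open Matrix

noncomputable section

attribute [local instance] Matrix.normedAddCommGroup Matrix.normedSpace

/-- Real power of a Hermitian (here: real symmetric) matrix, defined through its spectral
decomposition.  (Junk value `0` on non-Hermitian input.) -/
def mpow {k : ℕ} (Y : Matrix (Fin k) (Fin k) ℝ) (r : ℝ) : Matrix (Fin k) (Fin k) ℝ :=
  if h : Y.IsHermitian then
    (h.eigenvectorUnitary : Matrix (Fin k) (Fin k) ℝ) *
      Matrix.diagonal (fun i => h.eigenvalues i ^ r) *
      star (h.eigenvectorUnitary : Matrix (Fin k) (Fin k) ℝ)
  else 0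

/-- The continuous linear functional `H ↦ tr (A * H)`. -/
def traceCLM {m : ℕ} (A : Matrix (Fin m) (Fin m) ℝ) : Matrix (Fin m) (Fin m) ℝ →L[ℝ] ℝ :=
  LinearMap.toContinuousLinearMap
    ((Matrix.traceLinearMap (Fin m) ℝ ℝ).comp (LinearMap.mulLeft ℝ A))

theorem inv_hasFDerivAt {m : ℕ} (X : Matrix (Fin m) (Fin m) ℝ) (hX : IsUnit X) :
    ∃ L : Matrix (Fin m) (Fin m) ℝ →L[ℝ] Matrix (Fin m) (Fin m) ℝ,
      (∀ H, L H = -(X⁻¹ * H * X⁻¹)) ∧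
      HasFDerivAt (fun Y : Matrix (Fin m) (Fin m) ℝ => Y⁻¹) L X := by
  obtain ⟨u, rfl⟩ := hX
  have h : (fun Y : Matrix (Fin m) (Fin m) ℝ => Y⁻¹) = Ring.inverse := by
    ext1 Y; exact Matrix.nonsing_inv_eq_ringInverse Y
  have key := @hasFDerivAt_ringInverse ℝ _ (Matrix (Fin m) (Fin m) ℝ)
    Matrix.linftyOpNormedRing inferInstance Matrix.linftyOpNormedAlgebra u
  rw [h]
  refine ⟨_, ?_, key⟩
  intro H
  change -((↑u⁻¹ : Matrix (Fin m) (Fin m) ℝ) * H * (↑u⁻¹ : Matrix (Fin m) (Fin m) ℝ)) = _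
  rw [Matrix.coe_units_inv]

theorem posDef_aux {m k : ℕ} (K : Matrix (Fin m) (Fin k) ℝ) (hK : K.rank = k)
    (X : Matrix (Fin m) (Fin m) ℝ) (hX : X.PosDef) : (Kᵀ * X⁻¹ * K).PosDef := by
  have hinj : Function.Injective K.mulVec := by
    rw [Matrix.mulVec_injective_iff]
    rw [linearIndependent_iff_card_eq_finrank_span, Fintype.card_fin]
    rw [Matrix.rank_eq_finrank_span_cols] at hK
    exact hK.symm
  have := hX.inv.conjTranspose_mul_mul_same hinj
  simpa using this

/-- Scalar bound. -/
theorem scalar_bound (r : ℝ) (hr : 0 < r) (y : ℝ) (hy : 0 < y) (R : ℝ) (ε : ℝ) (hε : 0 < ε) :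
    ∃ C : ℝ, 0 ≤ C ∧ ∀ x : ℝ, |x| ≤ R →
      |x ^ r - y ^ r - r * y ^ (r - 1) * (x - y)| ≤ ε * |x - y| + C * (x - y) ^ 2 := by
  have hd : HasDerivAt (fun x : ℝ => x ^ r) (r * y ^ (r - 1)) y :=
    Real.hasDerivAt_rpow_const (Or.inl hy.ne')
  have ho := hasDerivAt_iff_isLittleO.1 hd
  have h1 := ho.def hε
  rw [Metric.eventually_nhds_iff] at h1
  obtain ⟨δ, hδ, h1⟩ := h1
  have hcont : Continuous (fun x : ℝ => x ^ r - y ^ r - r * y ^ (r - 1) * (x - y)) := by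
    have := Real.continuous_rpow_const hr.le
    fun_prop
  obtain ⟨B, hB⟩ := (isCompact_Icc (a := -R) (b := R)).exists_bound_of_continuousOn
    hcont.continuousOn
  refine ⟨|B| / δ ^ 2, by positivity, fun x hx => ?_⟩
  by_cases hxy : dist x y < δ
  · have h2 := h1 hxy
    simp only [Real.norm_eq_abs, smul_eq_mul] at h2
    have : 0 ≤ |B| / δ ^ 2 * (x - y) ^ 2 := by positivity
    rw [mul_comm (r * _)]
    linarith
  · have h2 := hB x (abs_le.1 hx)
    rw [Real.norm_eq_abs] at h2
    rw [Real.dist_eq] at hxy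
    push Not at hxy
    have h3 : δ ^ 2 ≤ (x - y) ^ 2 := by
      rw [← sq_abs (x - y)]; gcongr
    have h4 : |B| ≤ |B| / δ ^ 2 * (x - y) ^ 2 := by
      rw [div_mul_eq_mul_div, le_div_iff₀ (by positivity)]
      gcongr
    have : 0 ≤ ε * |x - y| := by positivity
    linarith [le_abs_self B]

theorem orth_entry {k : ℕ} (U : Matrix (Fin k) (Fin k) ℝ) (hU : Uᵀ * U = 1) (i j : Fin k) :
    |U i j| ≤ 1 := by
  have h := congrFun (congrFun hU j) j
  rw [Matrix.mul_apply, Matrix.one_apply_eq] at h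
  simp only [Matrix.transpose_apply] at h
  have h2 := Finset.single_le_sum (f := fun x => U x j * U x j)
    (fun x _ => mul_self_nonneg _) (Finset.mem_univ i)
  rw [← sq_le_one_iff_abs_le_one, sq]
  linarith

theorem conj_entry {k : ℕ} (U V D : Matrix (Fin k) (Fin k) ℝ) (hU : Uᵀ * U = 1)
    (hV : Vᵀ * V = 1) (i j : Fin k) :
    |(Uᵀ * D * V) i j| ≤ (k : ℝ) ^ 2 * ‖D‖ := by
  simp only [Matrix.mul_apply, Matrix.transpose_apply, Finset.sum_mul]
  calc |∑ b, ∑ a, U a i * D a b * V b j| ≤ ∑ b : Fin k, ∑ a : Fin k, ‖D‖ := by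
        refine (Finset.abs_sum_le_sum_abs _ _).trans (Finset.sum_le_sum fun b _ => ?_)
        refine (Finset.abs_sum_le_sum_abs _ _).trans (Finset.sum_le_sum fun a _ => ?_)
        rw [abs_mul, abs_mul]
        have h1 := orth_entry U hU a i
        have h2 := orth_entry V hV b j
        have h3 : |D a b| ≤ ‖D‖ := Matrix.norm_entry_le_entrywise_sup_norm D
        calc |U a i| * |D a b| * |V b j| ≤ 1 * ‖D‖ * 1 := by gcongr
          _ = ‖D‖ := by ring
    _ = _ := by simp; ring

/-- Klein-type identity and bound. -/
theorem klein {k : ℕ} (A B U V : Matrix (Fin k) (Fin k) ℝ) (l μ : Fin k → ℝ)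
    (f g : ℝ → ℝ) (hU : Uᵀ * U = 1) (hV : Vᵀ * V = 1)
    (hB : B = U * diagonal l * Uᵀ) (hA : A = V * diagonal μ * Vᵀ)
    (ε C : ℝ) (hε : 0 ≤ ε) (hC : 0 ≤ C)
    (hfg : ∀ i j, |f (l i) - f (μ j) - g (μ j) * (l i - μ j)|
      ≤ ε * |l i - μ j| + C * (l i - μ j) ^ 2) :
    |(∑ i, f (l i)) - (∑ j, f (μ j)) -
      ((V * diagonal (fun j => g (μ j)) * Vᵀ) * (B - A)).trace|
      ≤ (k : ℝ) ^ 2 * (ε * ((k : ℝ) ^ 2 * ‖B - A‖) + C * ((k : ℝ) ^ 2 * ‖B - A‖) ^ 2) := by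
  have hUT : U * Uᵀ = 1 := mul_eq_one_comm.1 hU
  have hVT : V * Vᵀ = 1 := mul_eq_one_comm.1 hV
  set c := Uᵀ * V with hc
  have hcc : cᵀ * c = 1 := by
    rw [hc, transpose_mul, transpose_transpose, Matrix.mul_assoc, ← Matrix.mul_assoc U, hUT,
      Matrix.one_mul, hV]
  have hccT : c * cᵀ = 1 := mul_eq_one_comm.1 hcc
  have hcol : ∀ j, ∑ i, c i j ^ 2 = 1 := fun j => by
    have h := congrFun (congrFun hcc j) j
    rw [Matrix.mul_apply, Matrix.one_apply_eq] at h
    simpa [sq] using h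
  have hrow : ∀ i, ∑ j, c i j ^ 2 = 1 := fun i => by
    have h := congrFun (congrFun hccT i) i
    rw [Matrix.mul_apply, Matrix.one_apply_eq] at h
    simpa [sq] using h
  have hent : ∀ i j, (Uᵀ * (B - A) * V) i j = (l i - μ j) * c i j := fun i j => by
    have : Uᵀ * (B - A) * V = diagonal l * c - c * diagonal μ := by
      rw [Matrix.mul_sub, Matrix.sub_mul, hA, hB, hc]
      congr 1
      · simp only [← Matrix.mul_assoc]; rw [hU, Matrix.one_mul]
      · simp only [Matrix.mul_assoc]; rw [hV, Matrix.mul_one]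
    rw [this, Matrix.sub_apply, Matrix.diagonal_mul, Matrix.mul_diagonal]; ring
  have htr : ((V * diagonal (fun j => g (μ j)) * Vᵀ) * (B - A)).trace
      = ∑ j, ∑ i, c i j ^ 2 * (g (μ j) * (l i - μ j)) := by
    have h1 : ((V * diagonal (fun j => g (μ j)) * Vᵀ) * (B - A)).trace
        = (diagonal (fun j => g (μ j)) * (cᵀ * (Uᵀ * (B - A) * V))).trace := by
      have : cᵀ * (Uᵀ * (B - A) * V) = Vᵀ * (B - A) * V := by
        rw [hc, transpose_mul, transpose_transpose]
        simp only [← Matrix.mul_assoc]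
        rw [Matrix.mul_assoc Vᵀ, hUT, Matrix.mul_one]
      rw [this, Matrix.mul_assoc, Matrix.mul_assoc, Matrix.trace_mul_comm]
      simp only [Matrix.mul_assoc]
    rw [h1, Matrix.trace]
    refine Finset.sum_congr rfl fun j _ => ?_
    rw [Matrix.diag_apply, Matrix.diagonal_mul, Matrix.mul_apply, Finset.mul_sum]
    refine Finset.sum_congr rfl fun i _ => ?_
    rw [hent, transpose_apply]; ring
  have hfl : ∑ i, f (l i) = ∑ j, ∑ i, c i j ^ 2 * f (l i) := by
    rw [Finset.sum_comm]
    refine Finset.sum_congr rfl fun i _ => ?_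
    rw [← Finset.sum_mul, hrow, one_mul]
  have hfm : ∑ j, f (μ j) = ∑ j, ∑ i, c i j ^ 2 * f (μ j) := by
    refine Finset.sum_congr rfl fun j _ => ?_
    rw [← Finset.sum_mul, hcol, one_mul]
  rw [htr, hfl, hfm]
  simp only [← Finset.sum_sub_distrib]
  set D := (k : ℝ) ^ 2 * ‖B - A‖ with hD
  have hterm : ∀ i j, |c i j ^ 2 * f (l i) - c i j ^ 2 * f (μ j)
      - c i j ^ 2 * (g (μ j) * (l i - μ j))| ≤ ε * D + C * D ^ 2 := fun i j => by
    have h1 : |l i - μ j| * |c i j| ≤ D := by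
      rw [← abs_mul, ← hent]; exact conj_entry U V _ hU hV i j
    have h2 : |c i j| ≤ 1 := orth_entry c hcc i j
    rw [← mul_sub, ← mul_sub, abs_mul, abs_of_nonneg (sq_nonneg (c i j))]
    calc c i j ^ 2 * |f (l i) - f (μ j) - g (μ j) * (l i - μ j)|
        ≤ c i j ^ 2 * (ε * |l i - μ j| + C * (l i - μ j) ^ 2) := by gcongr; exact hfg i j
      _ = ε * ((|l i - μ j| * |c i j|) * |c i j|) + C * (|l i - μ j| * |c i j|) ^ 2 := by
          rw [← sq_abs (c i j), ← sq_abs (l i - μ j)]; ring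
      _ ≤ ε * (D * 1) + C * D ^ 2 := by gcongr
      _ = _ := by ring
  calc _ ≤ ∑ j : Fin k, ∑ i : Fin k, (ε * D + C * D ^ 2) := by
        refine (Finset.abs_sum_le_sum_abs _ _).trans (Finset.sum_le_sum fun j _ => ?_)
        refine (Finset.abs_sum_le_sum_abs _ _).trans (Finset.sum_le_sum fun i _ => hterm i j)
    _ = _ := by simp; ring

theorem spec_form {k : ℕ} (A : Matrix (Fin k) (Fin k) ℝ) (h : A.IsHermitian) :
    ∃ U : Matrix (Fin k) (Fin k) ℝ, Uᵀ * U = 1 ∧ A = U * diagonal h.eigenvalues * Uᵀ ∧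
      ∀ r, mpow A r = U * diagonal (fun i => h.eigenvalues i ^ r) * Uᵀ := by
  refine ⟨h.eigenvectorUnitary, ?_, ?_, ?_⟩
  · have := Unitary.coe_star_mul_self h.eigenvectorUnitary
    rwa [Matrix.star_eq_conjTranspose, conjTranspose_eq_transpose_of_trivial] at this
  · have := h.spectral_theorem
    rw [Unitary.conjStarAlgAut_apply, Matrix.star_eq_conjTranspose, conjTranspose_eq_transpose_of_trivial] at this
    exact this
  · intro r
    rw [mpow, dif_pos h, Matrix.star_eq_conjTranspose, conjTranspose_eq_transpose_of_trivial]

theorem trace_mpow_hasFDeriv {k : ℕ} (A : Matrix (Fin k) (Fin k) ℝ) (hA : A.PosDef)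
    (r : ℝ) (hr : 0 < r) :
    HasFDerivWithinAt (fun B : Matrix (Fin k) (Fin k) ℝ => (mpow B r).trace)
      (r • traceCLM (mpow A (r - 1))) {B | B.IsSymm} A := by
  refine HasFDerivWithinAt.of_isLittleO ?_
  rw [Asymptotics.isLittleO_iff]
  intro ε hε
  obtain ⟨V, hV, hAV, hmA⟩ := spec_form A hA.isHermitian
  set R : ℝ := (k : ℝ) ^ 2 * (‖A‖ + 1) with hR
  set epsA : ℝ := ε / (2 * ((k : ℝ) ^ 4 + 1)) with hepsDef
  have hepsPos : 0 < epsA := by positivity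
  choose C hC0 hC using fun j => scalar_bound r hr (hA.isHermitian.eigenvalues j)
    (hA.eigenvalues_pos j) R epsA hepsPos
  set S : ℝ := ∑ j, C j with hS
  have hS0 : 0 ≤ S := Finset.sum_nonneg fun j _ => hC0 j
  set δ : ℝ := min 1 (ε / (2 * (S * (k : ℝ) ^ 6 + 1))) with hδ
  have hδ0 : 0 < δ := by positivity
  have hball : Metric.ball A δ ∈ nhdsWithin A {B | B.IsSymm} :=
    mem_nhdsWithin_of_mem_nhds (Metric.ball_mem_nhds _ hδ0)
  filter_upwards [hball, self_mem_nhdsWithin] with B hBd hBs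
  have hBh : B.IsHermitian := by
    rw [Matrix.IsHermitian, conjTranspose_eq_transpose_of_trivial]; exact hBs
  obtain ⟨U, hU, hBU, hmB⟩ := spec_form B hBh
  rw [Metric.mem_ball, dist_eq_norm] at hBd
  have hBn : ‖B‖ ≤ ‖A‖ + 1 := by
    have : ‖B‖ ≤ ‖B - A‖ + ‖A‖ := by simpa using norm_add_le (B - A) A
    have : δ ≤ 1 := min_le_left _ _
    linarith
  have hl : ∀ i, |hBh.eigenvalues i| ≤ R := fun i => by
    have h1 := conj_entry U U B hU hU i i
    have h2 : Uᵀ * B * U = diagonal hBh.eigenvalues := by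
      conv_lhs => rw [hBU]
      simp only [← Matrix.mul_assoc]
      rw [hU, Matrix.one_mul, Matrix.mul_assoc, hU, Matrix.mul_one]
    rw [h2, diagonal_apply_eq] at h1
    exact h1.trans (by rw [hR]; gcongr)
  have htr : ∀ (W : Matrix (Fin k) (Fin k) ℝ) (d : Fin k → ℝ), Wᵀ * W = 1 →
      (W * diagonal d * Wᵀ).trace = ∑ i, d i := fun W d hW => by
    rw [Matrix.trace_mul_comm, ← Matrix.mul_assoc, hW, Matrix.one_mul, Matrix.trace_diagonal]
  have hk := klein A B U V _ _ (fun x => x ^ r) (fun x => r * x ^ (r - 1)) hU hV hBU hAV epsA S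
    hepsPos.le hS0 (fun i j => (hC j _ (hl i)).trans (by
      gcongr; exact Finset.single_le_sum (fun j _ => hC0 j) (Finset.mem_univ j)))
  have hsm : V * diagonal (fun j => r * hA.isHermitian.eigenvalues j ^ (r - 1)) * Vᵀ
      = r • mpow A (r - 1) := by
    have : diagonal (fun j => r * hA.isHermitian.eigenvalues j ^ (r - 1))
      = r • diagonal (fun j => hA.isHermitian.eigenvalues j ^ (r - 1)) := by
      rw [← diagonal_smul]; rfl
    rw [this, hmA, Matrix.mul_smul, Matrix.smul_mul]
  have hval : (r • traceCLM (mpow A (r - 1))) (B - A) = ((r • mpow A (r - 1)) * (B - A)).trace := by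
    rw [Matrix.smul_mul, Matrix.trace_smul]; rfl
  change |(mpow B r).trace - (mpow A r).trace - (r • traceCLM (mpow A (r - 1))) (B - A)| ≤ _
  rw [hval, hmB, hmA, htr _ _ hU, htr _ _ hV, ← hsm]
  refine hk.trans ?_
  have hn := norm_nonneg (B - A)
  set n := ‖B - A‖
  have h1 : epsA * (k : ℝ) ^ 4 ≤ ε / 2 := by
    rw [hepsDef, div_mul_eq_mul_div, div_le_div_iff₀ (by positivity) (by positivity)]
    nlinarith
  have h2 : S * (k : ℝ) ^ 6 * n ≤ ε / 2 := by
    have h3 : n ≤ ε / (2 * (S * (k : ℝ) ^ 6 + 1)) := hBd.le.trans (min_le_right _ _)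
    have h4 : 0 ≤ S * (k : ℝ) ^ 6 := by positivity
    rw [le_div_iff₀ (by positivity)] at h3
    nlinarith
  calc _ = (epsA * (k : ℝ) ^ 4 + S * (k : ℝ) ^ 6 * n) * n := by ring
    _ ≤ (ε / 2 + ε / 2) * n := by gcongr
    _ = ε * n := by ring

/-- `Φ_p(X) = tr ((Kᵀ X⁻¹ K)^{-p})` is differentiable (within the symmetric matrices) at
every symmetric positive definite `X`, with derivative
`H ↦ p · tr (X⁻¹ K (Kᵀ X⁻¹ K)^{-p-1} Kᵀ X⁻¹ H)`. -/
theorem pth_mean_first_derivative (m k : ℕ) (hm : 1 ≤ m) (hk : 1 ≤ k) (hkm : k ≤ m)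
    (K : Matrix (Fin m) (Fin k) ℝ) (hK : K.rank = k) (p : ℝ) (hp : p < 0)
    (X : Matrix (Fin m) (Fin m) ℝ) (hX : X.PosDef) :
    HasFDerivWithinAt (fun Y : Matrix (Fin m) (Fin m) ℝ => (mpow (Kᵀ * Y⁻¹ * K) (-p)).trace)
      (p • traceCLM (X⁻¹ * K * mpow (Kᵀ * X⁻¹ * K) (-p - 1) * Kᵀ * X⁻¹))
      {Y : Matrix (Fin m) (Fin m) ℝ | Y.IsSymm} X := by
  obtain ⟨L, hL, hinv⟩ := inv_hasFDerivAt X hX.isUnit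
  let T : Matrix (Fin m) (Fin m) ℝ →L[ℝ] Matrix (Fin k) (Fin k) ℝ :=
    LinearMap.toContinuousLinearMap
      { toFun := fun Y => Kᵀ * Y * K
        map_add' := fun Y Z => by rw [Matrix.mul_add, Matrix.add_mul]
        map_smul' := fun c Y => by rw [Matrix.mul_smul, Matrix.smul_mul]; rfl }
  have hT : ∀ Y, T Y = Kᵀ * Y * K := fun Y => rfl
  have h1 : HasFDerivAt (fun Y : Matrix (Fin m) (Fin m) ℝ => Kᵀ * Y⁻¹ * K) (T.comp L) X :=
    T.hasFDerivAt.comp X hinv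
  have h2 := trace_mpow_hasFDeriv _ (posDef_aux K hK X hX) (-p) (by linarith)
  have hmaps : Set.MapsTo (fun Y : Matrix (Fin m) (Fin m) ℝ => Kᵀ * Y⁻¹ * K)
      {Y | Y.IsSymm} {B | B.IsSymm} := by
    intro Y hY
    have hYT : Yᵀ = Y := hY
    change (Kᵀ * Y⁻¹ * K)ᵀ = Kᵀ * Y⁻¹ * K
    rw [transpose_mul, transpose_mul, transpose_transpose, transpose_nonsing_inv, hYT,
      Matrix.mul_assoc]
  have h3 := HasFDerivWithinAt.comp X h2 h1.hasFDerivWithinAt hmaps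
  refine h3.congr_fderiv ?_
  ext1 H
  change -p * (mpow (Kᵀ * X⁻¹ * K) (-p - 1) * T (L H)).trace = p *
    (X⁻¹ * K * mpow (Kᵀ * X⁻¹ * K) (-p - 1) * Kᵀ * X⁻¹ * H).trace
  rw [hT, hL, Matrix.mul_neg, Matrix.neg_mul, Matrix.mul_neg, Matrix.trace_neg, neg_mul_neg]
  congr 1
  generalize mpow (Kᵀ * X⁻¹ * K) (-p - 1) = M
  calc (M * (Kᵀ * (X⁻¹ * H * X⁻¹) * K)).trace = ((M * Kᵀ * X⁻¹ * H) * (X⁻¹ * K)).trace := by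
        simp only [Matrix.mul_assoc]
    _ = ((X⁻¹ * K) * (M * Kᵀ * X⁻¹ * H)).trace := Matrix.trace_mul_comm _ _
    _ = _ := by simp only [Matrix.mul_assoc]
end
end

section
/- Let p < 0 and define Φ_p(X) = tr((K^T X^{-1} K)^{-p}) for m×m real symmetric positive definite X, where the matrix power is taken via the spectral decomposition of the positive definite matrix K^T X^{-1} K. Then Φ_p is twice differentiable at every positive definite X, the quadratic form H ↦ D²Φ_p(X)[H,H] is nonnegative on S^m, and for H ∈ S^m one has D²Φ_p(X)[H,H] = 0 if and only if K^T X^{-1} H = 0. -/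
open Matrix

noncomputable section

attribute [local instance] Matrix.normedAddCommGroup Matrix.normedSpace

open scoped Matrix.Norms.L2Operator in
theorem cfc_cont_aux {k : ℕ} (g : ℝ → ℝ) (hg : ContinuousOn g (Set.Ioi 0))
    (C : Matrix (Fin k) (Fin k) ℝ) (hC : C.PosDef) :
    @ContinuousWithinAt _ _ instTopologicalSpaceMatrix instTopologicalSpaceMatrix
      (cfc g : Matrix (Fin k) (Fin k) ℝ → _) {Y | IsSelfAdjoint Y} C := by
  have hs : spectrum ℝ C ⊆ Set.Ioi 0 := by
    rw [hC.1.spectrum_real_eq_range_eigenvalues]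
    rintro _ ⟨i, rfl⟩
    exact hC.eigenvalues_pos i
  have hs' : Set.Ioi (0:ℝ) ∈ nhdsSet (spectrum ℝ C) := isOpen_Ioi.mem_nhdsSet.2 hs
  have hcomp : IsCompact (spectrum ℝ C) := C.finite_real_spectrum.isCompact
  obtain ⟨t, ⟨hta, ht⟩, hts⟩ := hcomp.nhdsSet_basis_isCompact.mem_iff.mp hs'
  have h := continuousOn_cfc (Matrix (Fin k) (Fin k) ℝ) (p := IsSelfAdjoint) ht g (hg.mono hts)
  have h2 := (upperHemicontinuous_spectrum ℝ (Matrix (Fin k) (Fin k) ℝ)).isOpen t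
  have h3 := h C ⟨hC.1, subset_of_mem_nhdsSet hta⟩
  refine h3.mono_of_mem_nhdsWithin ?_
  filter_upwards [self_mem_nhdsWithin, mem_nhdsWithin_of_mem_nhds (h2.mem_nhds hta)] with Y h4 h5
  exact ⟨h4, subset_of_mem_nhdsSet h5⟩

theorem mpow_eq {k : ℕ} (Y : Matrix (Fin k) (Fin k) ℝ) (hY : Y.IsHermitian) (r : ℝ) :
    mpow Y r = cfc (fun x : ℝ => x ^ r) Y := by
  rw [Matrix.IsHermitian.cfc_eq hY, Matrix.IsHermitian.cfc, mpow, dif_pos hY]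
  rfl

theorem cfc_diag {k : ℕ} (Y : Matrix (Fin k) (Fin k) ℝ) (hY : Y.IsHermitian) (g : ℝ → ℝ) :
    cfc g Y = (hY.eigenvectorUnitary : Matrix (Fin k) (Fin k) ℝ) *
      Matrix.diagonal (fun i => g (hY.eigenvalues i)) *
      (hY.eigenvectorUnitary : Matrix (Fin k) (Fin k) ℝ)ᵀ := by
  rw [Matrix.IsHermitian.cfc_eq hY, Matrix.IsHermitian.cfc]
  rfl

theorem cfc_slope {k : ℕ} (Y : Matrix (Fin k) (Fin k) ℝ) (hY : Y.IsHermitian) (f : ℝ → ℝ) (a : ℝ) :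
    cfc f Y - f a • 1 = (Y - a • 1) * cfc (dslope f a) Y := by
  have hfin : ∀ g : ℝ → ℝ, ContinuousOn g (spectrum ℝ Y) := fun g =>
    (Y.finite_real_spectrum).continuousOn g
  have hY' : IsSelfAdjoint Y := hY
  have h1 : Y - a • 1 = cfc (fun x : ℝ => x - a) Y := by
    rw [cfc_sub (fun x => x) (fun _ => a) Y (hfin _) (hfin _), cfc_id' ℝ Y, cfc_const a Y]
    simp [Algebra.algebraMap_eq_smul_one]
  have h2 : cfc f Y - f a • 1 = cfc (fun x : ℝ => f x - f a) Y := by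
    rw [cfc_sub f (fun _ => f a) Y (hfin _) (hfin _), cfc_const (f a) Y]
    simp [Algebra.algebraMap_eq_smul_one]
  rw [h1, h2, ← cfc_mul _ _ Y (hfin _) (hfin _)]
  congr 1
  funext x
  have := sub_smul_dslope f a x
  simpa using this.symm

open Asymptotics in
/-- derivative of a factored difference -/
theorem hasFDerivWithinAt_factor {m a b ι : Type*} [Fintype m] [Fintype a] [Fintype b] [Fintype ι]
    (F : Matrix m m ℝ → Matrix a b ℝ) (s : Set (Matrix m m ℝ)) (X : Matrix m m ℝ)
    (A : ι → Matrix a m ℝ) (G : ι → Matrix m m ℝ → Matrix m b ℝ)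
    (hF : ∀ Y ∈ s, F Y - F X = ∑ i, A i * (Y - X) * G i Y)
    (hG : ∀ i, ContinuousWithinAt (G i) s X)
    (L : Matrix m m ℝ →L[ℝ] Matrix a b ℝ) (hL : ∀ E, L E = ∑ i, A i * E * G i X) :
    HasFDerivWithinAt F L s X := by
  refine hasFDerivWithinAt_iff_isLittleO.2 ?_
  have key : (fun Y => ∑ i, A i * (Y - X) * (G i Y - G i X)) =o[nhdsWithin X s] fun Y => Y - X := by
    have hi : ∀ i ∈ (Finset.univ : Finset ι), (fun Y => A i * (Y - X) * (G i Y - G i X))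
        =o[nhdsWithin X s] fun Y => Y - X := ?_
    · exact IsLittleO.fun_sum hi
    intro i _
    refine (isLittleO_pi (E' := fun _ : a => b → ℝ)).2 fun x => (isLittleO_pi (E' := fun _ : b => ℝ)).2 fun y => ?_
    simp only [Matrix.mul_apply, Finset.sum_mul]
    refine IsLittleO.fun_sum fun j _ => IsLittleO.fun_sum fun l _ => ?_
    have h1 : (fun Y : Matrix m m ℝ => A i x l * (Y - X) l j) =O[nhdsWithin X s] fun Y => Y - X := by
      refine IsBigO.const_mul_left ?_ _
      refine IsBigO.of_bound 1 (Filter.Eventually.of_forall fun Y => ?_)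
      rw [one_mul]
      exact Matrix.norm_entry_le_entrywise_sup_norm _
    have h2 : (fun Y : Matrix m m ℝ => (G i Y - G i X) j y) =o[nhdsWithin X s] fun _ => (1:ℝ) := by
      rw [isLittleO_one_iff]
      have : Filter.Tendsto (fun Y => G i Y j y - G i X j y) (nhdsWithin X s) (nhds (G i X j y - G i X j y)) :=
        (((continuous_apply_apply j y).tendsto (G i X)).comp (hG i)).sub_const _
      simpa using this
    have h3 := h1.norm_right.mul_isLittleO h2
    simp only [mul_one] at h3
    exact h3.of_norm_right
  refine key.congr' ?_ Filter.EventuallyEq.rfl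
  filter_upwards [self_mem_nhdsWithin] with Y hY
  have e : F Y - F X - L (Y - X) = ∑ i, A i * (Y - X) * (G i Y - G i X) := by
    rw [hF Y hY, hL, ← Finset.sum_sub_distrib]
    exact Finset.sum_congr rfl fun i _ => (Matrix.mul_sub _ _ _).symm
  exact e.symm

/-- matrix-function derivative (Daleckii-Krein) -/
theorem cfc_hasFDeriv {k : ℕ} (f : ℝ → ℝ) (hf : ∀ x : ℝ, 0 < x → DifferentiableAt ℝ f x)
    (C : Matrix (Fin k) (Fin k) ℝ) (hC : C.PosDef) :
    ∃ L : Matrix (Fin k) (Fin k) ℝ →L[ℝ] Matrix (Fin k) (Fin k) ℝ,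
      (∀ E, L E = (hC.1.eigenvectorUnitary : Matrix (Fin k) (Fin k) ℝ) *
        (Matrix.of fun i j => dslope f (hC.1.eigenvalues i) (hC.1.eigenvalues j) *
          ((hC.1.eigenvectorUnitary : Matrix (Fin k) (Fin k) ℝ)ᵀ * E *
            (hC.1.eigenvectorUnitary : Matrix (Fin k) (Fin k) ℝ)) i j) *
        (hC.1.eigenvectorUnitary : Matrix (Fin k) (Fin k) ℝ)ᵀ) ∧
      HasFDerivWithinAt (fun Y : Matrix (Fin k) (Fin k) ℝ => cfc f Y) L {Y | IsSelfAdjoint Y} C := by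
  have hCf : ∀ g : ℝ → ℝ, cfc g C = _ := fun g => cfc_diag C hC.1 g
  have hCsa : IsSelfAdjoint C := hC.1
  have hpos := hC.eigenvalues_pos
  set U := (hC.1.eigenvectorUnitary : Matrix (Fin k) (Fin k) ℝ) with hU
  set l := hC.1.eigenvalues with hl
  have hUU : Uᵀ * U = 1 := Unitary.coe_star_mul_self hC.1.eigenvectorUnitary
  have hUU' : U * Uᵀ = 1 := Unitary.coe_mul_star_self hC.1.eigenvectorUnitary
  set A : Fin k → Matrix (Fin k) (Fin k) ℝ := fun i => U * Matrix.single i i 1 * Uᵀ with hA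
  have hA1 : ∑ i, A i = 1 := by
    have : ∑ i : Fin k, Matrix.single i i (1:ℝ) = 1 := by
      rw [← Matrix.diagonal_one, ← Matrix.sum_single_eq_diagonal]
    rw [hA]; simp only
    rw [← Finset.sum_mul, ← Finset.mul_sum, this, mul_one, hUU']
  have hAf : ∀ g i, A i * cfc g C = g (l i) • A i := by
    intro g i
    rw [hCf g]
    calc A i * (U * diagonal (fun i => g (l i)) * Uᵀ)
        = U * (Matrix.single i i 1 * (Uᵀ * U) * diagonal (fun i => g (l i))) * Uᵀ := by
          simp only [hA, Matrix.mul_assoc]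
      _ = U * (g (l i) • Matrix.single i i 1) * Uᵀ := by
          rw [hUU, mul_one]
          congr 2
          ext a b
          simp only [Matrix.mul_diagonal, Matrix.smul_apply, Matrix.single_apply, smul_eq_mul]
          split_ifs with h
          · rw [h.2]; ring
          · ring
      _ = _ := by rw [Matrix.mul_smul, Matrix.smul_mul]
  have hAC : ∀ i, A i * C = l i • A i := by
    intro i
    have := hAf (fun x => x) i
    rwa [cfc_id' ℝ C hCsa] at this
  let L0 : Matrix (Fin k) (Fin k) ℝ →ₗ[ℝ] Matrix (Fin k) (Fin k) ℝ :=
    { toFun := fun E => ∑ i, A i * E * cfc (dslope f (l i)) C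
      map_add' := fun E F => by simp [Matrix.mul_add, Matrix.add_mul, Finset.sum_add_distrib]
      map_smul' := fun c E => by simp [Finset.smul_sum] }
  refine ⟨LinearMap.toContinuousLinearMap L0, ?_, ?_⟩
  · intro E
    change ∑ i, A i * E * cfc (dslope f (l i)) C = _
    have : ∀ i, A i * E * cfc (dslope f (l i)) C =
        U * (Matrix.single i i 1 * (Uᵀ * E * U) * diagonal (fun j => dslope f (l i) (l j))) * Uᵀ := by
      intro i
      rw [hCf]
      simp only [hA, Matrix.mul_assoc]
    simp only [this]
    rw [← Finset.sum_mul, ← Finset.mul_sum]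
    congr 2
    ext a b
    rw [Matrix.sum_apply, Finset.sum_eq_single a]
    · simp [Matrix.mul_diagonal, mul_comm]
    · intro c _ hc
      simp [Matrix.mul_diagonal, hc.symm]
    · simp
  · refine hasFDerivWithinAt_factor (ι := Fin k) _ _ C A (fun i Y => cfc (dslope f (l i)) Y) ?_ ?_ _ (fun E => rfl)
    · intro Y hY
      have h1 : ∀ i, A i * (Y - C) * cfc (dslope f (l i)) Y = A i * cfc f Y - A i * cfc f C := by
        intro i
        have : A i * (Y - C) = A i * (Y - l i • 1) := by
          simp [Matrix.mul_sub, hAC]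
        rw [this, Matrix.mul_assoc, ← cfc_slope Y hY, hAf]
        simp [Matrix.mul_sub]
      simp only [h1]
      have h2 : ∀ Z : Matrix (Fin k) (Fin k) ℝ, ∑ i, A i * Z = Z := fun Z => by
        rw [← Finset.sum_mul Finset.univ A Z, hA1, one_mul]
      rw [Finset.sum_sub_distrib, h2, h2]
    · intro i
      refine cfc_cont_aux _ ?_ C hC
      exact (continuousOn_dslope (isOpen_Ioi.mem_nhds (hpos i))).2
        ⟨fun x hx => (hf x hx).continuousAt.continuousWithinAt, hf _ (hpos i)⟩

theorem inv_hasFDeriv {m a b : ℕ} (P : Matrix (Fin a) (Fin m) ℝ) (Q : Matrix (Fin m) (Fin b) ℝ)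
    (X : Matrix (Fin m) (Fin m) ℝ) (hX : X.PosDef) :
    ∃ L : Matrix (Fin m) (Fin m) ℝ →L[ℝ] Matrix (Fin a) (Fin b) ℝ,
      (∀ E, L E = -(P * X⁻¹ * E * X⁻¹ * Q)) ∧
      HasFDerivAt (fun Y : Matrix (Fin m) (Fin m) ℝ => P * Y⁻¹ * Q) L X := by
  let L0 : Matrix (Fin m) (Fin m) ℝ →ₗ[ℝ] Matrix (Fin a) (Fin b) ℝ :=
    { toFun := fun E => -(P * X⁻¹ * E * X⁻¹ * Q)
      map_add' := fun E F => by simp [Matrix.mul_add, Matrix.add_mul, add_comm]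
      map_smul' := fun c E => by simp }
  have hXd : X.det ≠ 0 := hX.det_pos.ne'
  refine ⟨LinearMap.toContinuousLinearMap L0, fun E => rfl, ?_⟩
  have hcd : Continuous (fun Y : Matrix (Fin m) (Fin m) ℝ => Y.det) := Continuous.matrix_det continuous_id
  have hs : {Y : Matrix (Fin m) (Fin m) ℝ | Y.det ≠ 0} ∈ nhds X :=
    (isOpen_ne.preimage hcd).mem_nhds hXd
  have hinv : ContinuousAt (fun Y : Matrix (Fin m) (Fin m) ℝ => Y⁻¹) X := by
    apply continuousAt_matrix_inv
    rw [Ring.inverse_eq_inv']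
    exact continuousAt_inv₀ hXd
  refine HasFDerivWithinAt.hasFDerivAt ?_ hs
  refine hasFDerivWithinAt_factor (ι := Unit) _ _ X (fun _ => -(P * X⁻¹)) (fun _ Y => Y⁻¹ * Q) ?_ ?_ _ ?_
  · intro Y hY
    have e1 : Y * Y⁻¹ = 1 := Matrix.mul_nonsing_inv _ (isUnit_iff_ne_zero.2 hY)
    have e2 : X⁻¹ * X = 1 := Matrix.nonsing_inv_mul _ (isUnit_iff_ne_zero.2 hXd)
    simp only [Finset.univ_unique, Finset.sum_singleton]
    calc P * Y⁻¹ * Q - P * X⁻¹ * Q = P * (X⁻¹ * X) * Y⁻¹ * Q - P * X⁻¹ * (Y * Y⁻¹) * Q := by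
          rw [e1, e2]; simp
      _ = _ := by
          simp only [Matrix.mul_sub, Matrix.sub_mul, Matrix.neg_mul, Matrix.mul_assoc]; abel
  · intro _
    have hc : Continuous (fun Z : Matrix (Fin m) (Fin m) ℝ => Z * Q) :=
      continuous_id.matrix_mul continuous_const
    exact (hc.continuousAt.comp hinv).continuousWithinAt
  · intro E
    simp only [Finset.univ_unique, Finset.sum_singleton]
    change -(P * X⁻¹ * E * X⁻¹ * Q) = _
    simp only [Matrix.neg_mul, Matrix.mul_assoc]

theorem hasDerivAt_mmul {a b c : ℕ} {A : ℝ → Matrix (Fin a) (Fin b) ℝ}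
    {B : ℝ → Matrix (Fin b) (Fin c) ℝ} {A' : Matrix (Fin a) (Fin b) ℝ} {B' : Matrix (Fin b) (Fin c) ℝ} {t : ℝ}
    (hA : HasDerivAt A A' t) (hB : HasDerivAt B B' t) :
    HasDerivAt (fun s => A s * B s) (A' * B t + A t * B') t := by
  have hA2 : ∀ i j, HasDerivAt (fun s => A s i j) (A' i j) t := fun i j =>
    hasDerivAt_pi.1 (hasDerivAt_pi.1 hA i) j
  have hB2 : ∀ i j, HasDerivAt (fun s => B s i j) (B' i j) t := fun i j =>
    hasDerivAt_pi.1 (hasDerivAt_pi.1 hB i) j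
  refine hasDerivAt_pi.2 fun i => hasDerivAt_pi.2 fun j => ?_
  simp only [Matrix.mul_apply, Matrix.add_apply, ← Finset.sum_add_distrib]
  exact HasDerivAt.fun_sum fun l _ => (hA2 i l).mul (hB2 l j)

theorem hasDerivAt_mtrace {a : ℕ} {A : ℝ → Matrix (Fin a) (Fin a) ℝ}
    {A' : Matrix (Fin a) (Fin a) ℝ} {t : ℝ} (hA : HasDerivAt A A' t) :
    HasDerivAt (fun s => (A s).trace) A'.trace t := by
  have hA2 : ∀ i j, HasDerivAt (fun s => A s i j) (A' i j) t := fun i j =>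
    hasDerivAt_pi.1 (hasDerivAt_pi.1 hA i) j
  simp only [Matrix.trace, Matrix.diag]
  exact HasDerivAt.fun_sum fun l _ => hA2 l l

theorem coef_pos (r : ℝ) (hr : 0 < r) (x y : ℝ) (hx : 0 < x) (hy : 0 < y) :
    0 < x ^ (r - 1) * y⁻¹ + y ^ (r - 1) * x⁻¹ + dslope (fun z : ℝ => z ^ (r - 1)) x y := by
  rcases eq_or_ne y x with rfl | h
  · rw [dslope_same, (Real.hasDerivAt_rpow_const (Or.inl hx.ne')).deriv]
    have e : y ^ (r - 1) = y ^ (r - 1 - 1) * y := by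
      rw [← Real.rpow_add_one hx.ne']; congr 1; ring
    rw [e]
    have h2 : 0 < y ^ (r - 1 - 1) := Real.rpow_pos_of_pos hx _
    have : y ^ (r - 1 - 1) * y * y⁻¹ + y ^ (r - 1 - 1) * y * y⁻¹ + (r - 1) * y ^ (r - 1 - 1)
      = (r + 1) * y ^ (r - 1 - 1) := by field_simp; ring
    rw [this]; positivity
  · rw [dslope_of_ne _ h, slope_def_field]
    have ex : x ^ (r + 1) = x ^ (r - 1) * x ^ 2 := by
      rw [← Real.rpow_natCast x 2, ← Real.rpow_add hx]; congr 1; push_cast; ring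
    have ey : y ^ (r + 1) = y ^ (r - 1) * y ^ 2 := by
      rw [← Real.rpow_natCast y 2, ← Real.rpow_add hy]; congr 1; push_cast; ring
    have hyx : y - x ≠ 0 := sub_ne_zero.2 h
    have key : x ^ (r - 1) * y⁻¹ + y ^ (r - 1) * x⁻¹ + (y ^ (r - 1) - x ^ (r - 1)) / (y - x)
      = (x * y)⁻¹ * ((y ^ (r + 1) - x ^ (r + 1)) / (y - x)) := by
      rw [ex, ey]; field_simp; ring
    rw [key]
    refine mul_pos (by positivity) ?_
    rcases lt_or_gt_of_ne h with h' | h'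
    · exact div_pos_of_neg_of_neg (sub_neg.2 (Real.rpow_lt_rpow hy.le h' (by linarith))) (sub_neg.2 h')
    · exact div_pos (sub_pos.2 (Real.rpow_lt_rpow hx.le h' (by linarith))) (sub_pos.2 h')

theorem core_pos {m k : ℕ} (K : Matrix (Fin m) (Fin k) ℝ) (W H : Matrix (Fin m) (Fin m) ℝ)
    (hW : W.PosDef) (hH : H.IsSymm) (l : Fin k → ℝ) (hl : ∀ i, 0 < l i) (r : ℝ) (hr : 0 < r)
    (hK : Kᵀ * W * K = diagonal l) :
    0 ≤ 2 * ∑ i, l i ^ (r - 1) * (Kᵀ * W * H * W * H * W * K) i i +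
      ∑ i, ∑ j, dslope (fun z : ℝ => z ^ (r - 1)) (l i) (l j) * ((Kᵀ * W * H * W * K) i j) ^ 2 ∧
    (2 * ∑ i, l i ^ (r - 1) * (Kᵀ * W * H * W * H * W * K) i i +
      ∑ i, ∑ j, dslope (fun z : ℝ => z ^ (r - 1)) (l i) (l j) * ((Kᵀ * W * H * W * K) i j) ^ 2 = 0
      → Kᵀ * W * H = 0) := by
  have hWt : Wᵀ = W := hW.1
  have hHt : Hᵀ = H := hH
  set N := Kᵀ * W * H * W * K with hN
  have hNt : Nᵀ = N := by
    simp only [hN, Matrix.transpose_mul, Matrix.transpose_transpose, hWt, hHt, Matrix.mul_assoc]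
  have hNs : ∀ i j, N i j = N j i := fun i j => by
    conv_lhs => rw [← hNt]
    rfl
  set D := diagonal (fun i => (l i)⁻¹) with hD
  have hDt : Dᵀ = D := by rw [hD, Matrix.diagonal_transpose]
  have hDl : D * diagonal l = 1 := by
    rw [hD, Matrix.diagonal_mul_diagonal, ← Matrix.diagonal_one]
    congr 1; funext i; exact inv_mul_cancel₀ (hl i).ne'
  set Z := H * W * K - K * D * N with hZ
  have hS : Kᵀ * W * H * W * H * W * K = Zᵀ * W * Z + N * D * N := by
    have h1 : Zᵀ = Kᵀ * W * H - N * D * Kᵀ := by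
      simp only [hZ, Matrix.transpose_sub, Matrix.transpose_mul, hWt, hHt, hNt, hDt, Matrix.mul_assoc]
    have h2 : Zᵀ * W * Z = Kᵀ * W * H * W * H * W * K - (Kᵀ * W * H * W * K) * D * N
        - N * D * (Kᵀ * W * H * W * K) + N * (D * (Kᵀ * W * K)) * D * N := by
      rw [h1, hZ]
      simp only [Matrix.mul_sub, Matrix.sub_mul, Matrix.mul_assoc]
      abel
    rw [h2, ← hN, hK, hDl, mul_one]
    abel
  set T := Zᵀ * W * Z with hT
  have hTii : ∀ i, T i i = (fun a => Z a i) ⬝ᵥ (W *ᵥ (fun a => Z a i)) := by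
    intro i
    rw [hT, Matrix.mul_assoc, Matrix.mul_apply_eq_vecMul]
    simp only [Matrix.vecMul, Matrix.mulVec, Matrix.mul_apply, dotProduct, Matrix.transpose_apply]
  have hT0 : ∀ i, 0 ≤ T i i := fun i => by
    rw [hTii]; simpa using hW.posSemidef.dotProduct_mulVec_nonneg (fun a => Z a i)
  have hTZ : (∀ i, T i i = 0) → Z = 0 := by
    intro h
    ext a i
    by_contra hne
    have hz : (fun a => Z a i) ≠ 0 := fun h0 => hne (congrFun h0 a)
    have := hW.dotProduct_mulVec_pos hz
    have h2 := h i
    rw [hTii] at h2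
    simp only [star_trivial] at this
    linarith
  have hSii : ∀ i, (Kᵀ * W * H * W * H * W * K) i i = T i i + ∑ j, (l j)⁻¹ * N i j ^ 2 := by
    intro i
    rw [hS, Matrix.add_apply]
    congr 1
    rw [Matrix.mul_apply]
    refine Finset.sum_congr rfl fun j _ => ?_
    rw [hD, Matrix.mul_diagonal, hNs j i]; ring
  have hsym : ∑ i, ∑ j, l i ^ (r - 1) * (l j)⁻¹ * N i j ^ 2 =
      ∑ i, ∑ j, l j ^ (r - 1) * (l i)⁻¹ * N i j ^ 2 := by
    rw [Finset.sum_comm]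
    refine Finset.sum_congr rfl fun j _ => Finset.sum_congr rfl fun i _ => ?_
    rw [hNs]
  have hmain : 2 * ∑ i, l i ^ (r - 1) * (Kᵀ * W * H * W * H * W * K) i i +
      ∑ i, ∑ j, dslope (fun z : ℝ => z ^ (r - 1)) (l i) (l j) * (N i j) ^ 2 =
      ∑ i, 2 * (l i ^ (r - 1) * T i i) + ∑ i, ∑ j, (l i ^ (r - 1) * (l j)⁻¹ + l j ^ (r - 1) * (l i)⁻¹ +
        dslope (fun z : ℝ => z ^ (r - 1)) (l i) (l j)) * N i j ^ 2 := by
    simp only [hSii, mul_add, add_mul, Finset.sum_add_distrib, Finset.mul_sum, ← mul_assoc]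
    simp only [mul_assoc, ← Finset.mul_sum]
    simp only [mul_assoc, ← Finset.mul_sum] at hsym
    rw [← hsym]; ring
  rw [hmain]
  have p1 : ∀ i ∈ Finset.univ, 0 ≤ 2 * (l i ^ (r - 1) * T i i) := fun i _ =>
    mul_nonneg (by norm_num) (mul_nonneg (Real.rpow_pos_of_pos (hl i) _).le (hT0 i))
  have p2 : ∀ i j, 0 ≤ (l i ^ (r - 1) * (l j)⁻¹ + l j ^ (r - 1) * (l i)⁻¹ +
        dslope (fun z : ℝ => z ^ (r - 1)) (l i) (l j)) * N i j ^ 2 := fun i j =>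
    mul_nonneg (coef_pos r hr _ _ (hl i) (hl j)).le (sq_nonneg _)
  have p3 : ∀ i ∈ Finset.univ, 0 ≤ ∑ j, (l i ^ (r - 1) * (l j)⁻¹ + l j ^ (r - 1) * (l i)⁻¹ +
        dslope (fun z : ℝ => z ^ (r - 1)) (l i) (l j)) * N i j ^ 2 := fun i _ =>
    Finset.sum_nonneg fun j _ => p2 i j
  refine ⟨add_nonneg (Finset.sum_nonneg p1) (Finset.sum_nonneg p3), fun h0 => ?_⟩
  obtain ⟨h1, h2⟩ := (add_eq_zero_iff_of_nonneg (Finset.sum_nonneg p1) (Finset.sum_nonneg p3)).1 h0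
  have hN0 : N = 0 := by
    ext i j
    have h3 := (Finset.sum_eq_zero_iff_of_nonneg p3).1 h2 i (Finset.mem_univ _)
    have h4 := (Finset.sum_eq_zero_iff_of_nonneg (fun j _ => p2 i j)).1 h3 j (Finset.mem_univ _)
    rcases mul_eq_zero.1 h4 with h5 | h5
    · exact absurd h5 (coef_pos r hr _ _ (hl i) (hl j)).ne'
    · simpa using h5
  have hZ0 : Z = 0 := hTZ fun i => by
    have h3 := (Finset.sum_eq_zero_iff_of_nonneg p1).1 h1 i (Finset.mem_univ _)
    have h4 := (Real.rpow_pos_of_pos (hl i) (r - 1)).ne'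
    simpa [h4] using h3
  rw [hZ, hN0, Matrix.mul_zero, sub_zero] at hZ0
  have := congrArg Matrix.transpose hZ0
  simpa [Matrix.transpose_mul, hWt, hHt, Matrix.mul_assoc] using this

/-- `Φ_p` is twice differentiable at every symmetric positive definite `X`, its second
derivative quadratic form is nonnegative on symmetric matrices, and it vanishes at a
symmetric `H` iff `Kᵀ X⁻¹ H = 0`. -/
theorem pth_mean_second_derivative_nonneg (m k : ℕ) (hm : 1 ≤ m) (hk : 1 ≤ k) (hkm : k ≤ m)
    (K : Matrix (Fin m) (Fin k) ℝ) (hK : K.rank = k) (p : ℝ) (hp : p < 0)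
    (X : Matrix (Fin m) (Fin m) ℝ) (hX : X.PosDef) :
    HasFDerivWithinAt (fun Y : Matrix (Fin m) (Fin m) ℝ => (mpow (Kᵀ * Y⁻¹ * K) (-p)).trace)
      (p • traceCLM (X⁻¹ * K * mpow (Kᵀ * X⁻¹ * K) (-p - 1) * Kᵀ * X⁻¹))
      {Y : Matrix (Fin m) (Fin m) ℝ | Y.IsSymm} X ∧
    ∀ H : Matrix (Fin m) (Fin m) ℝ, H.IsSymm →
      ∃ q : ℝ,
        HasDerivAt (fun t : ℝ =>
          p * ((X + t • H)⁻¹ * K * mpow (Kᵀ * (X + t • H)⁻¹ * K) (-p - 1) * Kᵀ *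
            (X + t • H)⁻¹ * H).trace) q 0 ∧
        0 ≤ q ∧ (q = 0 ↔ Kᵀ * X⁻¹ * H = 0) := by
  set r := -p with hr
  have hrpos : 0 < r := by linarith
  have hpr : p = -r := by rw [hr]; ring
  have hKinj : Function.Injective K.mulVec := by
    rw [Matrix.mulVec_injective_iff]
    rw [linearIndependent_iff_card_eq_finrank_span, Set.finrank, ← Matrix.rank_eq_finrank_span_cols, hK]
    simp
  have hW : X⁻¹.PosDef := hX.inv
  have hC : (Kᵀ * X⁻¹ * K).PosDef := by
    have := hW.conjTranspose_mul_mul_same hKinj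
    simpa using this
  have hherm : ∀ Y : Matrix (Fin m) (Fin m) ℝ, Y.IsSymm → (Kᵀ * Y⁻¹ * K).IsHermitian := by
    intro Y hY
    have : Yᵀ = Y := hY
    simp [Matrix.IsHermitian, Matrix.conjTranspose_eq_transpose_of_trivial, Matrix.transpose_mul,
      Matrix.transpose_nonsing_inv, this, Matrix.mul_assoc]
  have hmpow : ∀ s : ℝ, mpow (Kᵀ * X⁻¹ * K) s = _ := fun s =>
    (mpow_eq _ hC.1 s).trans (cfc_diag _ hC.1 _)
  have hdiff : ∀ s x : ℝ, 0 < x → DifferentiableAt ℝ (fun z : ℝ => z ^ s) x := fun s x hx =>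
    (Real.hasDerivAt_rpow_const (Or.inl hx.ne')).differentiableAt
  obtain ⟨Li, hLi, hDi⟩ := inv_hasFDeriv Kᵀ K X hX
  obtain ⟨L1, hL1, hD1⟩ := cfc_hasFDeriv (fun z : ℝ => z ^ r) (hdiff r) _ hC
  obtain ⟨L2, hL2, hD2⟩ := cfc_hasFDeriv (fun z : ℝ => z ^ (r - 1)) (hdiff (r - 1)) _ hC
  have hlpos := hC.eigenvalues_pos
  have hspec : Kᵀ * X⁻¹ * K = _ :=
    (cfc_id' ℝ (Kᵀ * X⁻¹ * K) (show IsSelfAdjoint _ from hC.1)).symm.trans (cfc_diag _ hC.1 (fun x => x))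
  have hUU : (hC.1.eigenvectorUnitary : Matrix (Fin k) (Fin k) ℝ)ᵀ *
    (hC.1.eigenvectorUnitary : Matrix (Fin k) (Fin k) ℝ) = 1 :=
    Unitary.coe_star_mul_self hC.1.eigenvectorUnitary
  have hUU' : (hC.1.eigenvectorUnitary : Matrix (Fin k) (Fin k) ℝ) *
    (hC.1.eigenvectorUnitary : Matrix (Fin k) (Fin k) ℝ)ᵀ = 1 :=
    Unitary.coe_mul_star_self hC.1.eigenvectorUnitary
  generalize (hC.1.eigenvectorUnitary : Matrix (Fin k) (Fin k) ℝ) = U at *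
  generalize hC.1.eigenvalues = l at *
  refine ⟨?_, ?_⟩
  · have hmaps : Set.MapsTo (fun Y : Matrix (Fin m) (Fin m) ℝ => Kᵀ * Y⁻¹ * K) {Y | Y.IsSymm}
        {Y | IsSelfAdjoint Y} := fun Y hY => hherm Y hY
    have h1 := hD1.comp X (hDi.hasFDerivWithinAt (s := {Y | Y.IsSymm})) hmaps
    have h2 := (LinearMap.toContinuousLinearMap
      (Matrix.traceLinearMap (Fin k) ℝ ℝ)).hasFDerivAt.comp_hasFDerivWithinAt X h1
    have h3 : HasFDerivWithinAt
        (fun Y : Matrix (Fin m) (Fin m) ℝ => (mpow (Kᵀ * Y⁻¹ * K) r).trace) _ {Y | Y.IsSymm} X :=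
      h2.congr (fun Y hY => by rw [mpow_eq _ (hherm Y hY)]; rfl)
        (by rw [mpow_eq _ hC.1]; rfl)
    refine h3.congr_fderiv ?_
    ext1 E
    change (L1 (Li E)).trace = p * (X⁻¹ * K * mpow (Kᵀ * X⁻¹ * K) (r - 1) * Kᵀ * X⁻¹ * E).trace
    have e1 : (X⁻¹ * K * mpow (Kᵀ * X⁻¹ * K) (r - 1) * Kᵀ * X⁻¹ * E).trace =
        (diagonal (fun i => l i ^ (r - 1)) * (Uᵀ * (Kᵀ * X⁻¹ * E * X⁻¹ * K) * U)).trace := by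
      rw [hmpow]
      rw [show X⁻¹ * K * (U * diagonal (fun i => l i ^ (r - 1)) * Uᵀ) * Kᵀ * X⁻¹ * E =
        (X⁻¹ * K * U) * (diagonal (fun i => l i ^ (r - 1)) * Uᵀ * Kᵀ * X⁻¹ * E) by
          simp only [Matrix.mul_assoc]]
      rw [Matrix.trace_mul_comm]
      simp only [Matrix.mul_assoc]
    rw [e1, hL1, hLi, Matrix.trace_mul_comm, ← Matrix.mul_assoc, hUU, one_mul, Matrix.trace,
      Matrix.trace, Finset.mul_sum]
    refine Finset.sum_congr rfl fun i _ => ?_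
    simp only [Matrix.diag, Matrix.of_apply, Matrix.diagonal_mul, dslope_same]
    rw [(Real.hasDerivAt_rpow_const (Or.inl (hlpos i).ne')).deriv, Matrix.mul_neg, Matrix.neg_mul,
      Matrix.neg_apply, hpr]
    ring
  · intro H hH
    have hcurve : HasDerivAt (fun t : ℝ => X + t • H) H 0 := by
      have h1 : HasDerivAt (fun t : ℝ => X + t • H) ((1 : ℝ) • H) 0 :=
        ((hasDerivAt_id (0 : ℝ)).smul_const H).const_add X
      rwa [one_smul] at h1
    have hc0 : X = X + (0:ℝ) • H := by simp
    have hcs : ∀ t : ℝ, (X + t • H).IsSymm := fun t => by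
      have hXs : X.IsSymm := hX.1
      exact hXs.add (hH.smul t)
    have hinvP : ∀ {a b : ℕ} (P : Matrix (Fin a) (Fin m) ℝ) (Q : Matrix (Fin m) (Fin b) ℝ),
        HasDerivAt (fun t : ℝ => P * (X + t • H)⁻¹ * Q) (-(P * X⁻¹ * H * X⁻¹ * Q)) 0 := by
      intro a b P Q
      obtain ⟨L, hL, hD⟩ := inv_hasFDeriv P Q X hX
      rw [← hL]
      exact hD.comp_hasDerivAt_of_eq (0:ℝ) hcurve hc0
    have hB := hinvP (1 : Matrix (Fin m) (Fin m) ℝ) K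
    have hB' := hinvP Kᵀ H
    have hM : HasDerivAt (fun t : ℝ => mpow (Kᵀ * (X + t • H)⁻¹ * K) (r - 1))
        (L2 (-(Kᵀ * X⁻¹ * H * X⁻¹ * K))) 0 := by
      have h1 := hD2.comp_hasDerivAt_of_eq (0:ℝ) (hinvP Kᵀ K)
        (Filter.Eventually.of_forall fun t => hherm _ (hcs t)) (by simp)
      refine h1.congr_of_eventuallyEq (Filter.Eventually.of_forall fun t => ?_)
      exact mpow_eq _ (hherm _ (hcs t)) _
    have hF := (hasDerivAt_mtrace (hasDerivAt_mmul (hasDerivAt_mmul hB hM) hB')).const_mul p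
    have hq : HasDerivAt (fun t : ℝ =>
          p * ((X + t • H)⁻¹ * K * mpow (Kᵀ * (X + t • H)⁻¹ * K) (r - 1) * Kᵀ *
            (X + t • H)⁻¹ * H).trace) (r * (2 * ∑ i, l i ^ (r - 1) *
              ((K * U)ᵀ * X⁻¹ * H * X⁻¹ * H * X⁻¹ * (K * U)) i i +
      ∑ i, ∑ j, dslope (fun z : ℝ => z ^ (r - 1)) (l i) (l j) *
        (((K * U)ᵀ * X⁻¹ * H * X⁻¹ * (K * U)) i j) ^ 2)) 0 := by
      refine HasDerivAt.congr_of_eventuallyEq (hF.congr_deriv ?_)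
        (Filter.Eventually.of_forall fun t => ?_)
      rotate_left
      · simp only [Matrix.one_mul, Matrix.mul_assoc]
      · simp only [zero_smul, add_zero, Matrix.one_mul]
        rw [hmpow, hL2]
        set N := (K * U)ᵀ * X⁻¹ * H * X⁻¹ * (K * U) with hN
        set S := (K * U)ᵀ * X⁻¹ * H * X⁻¹ * H * X⁻¹ * (K * U) with hS
        have hWt : X⁻¹ᵀ = X⁻¹ := hW.1
        have hHt : Hᵀ = H := hH
        have hNt : Nᵀ = N := by
          simp only [hN, Matrix.transpose_mul, Matrix.transpose_transpose, hWt, hHt, Matrix.mul_assoc]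
        have hNs : ∀ i j, N i j = N j i := fun i j => by
          conv_lhs => rw [← hNt]
          rfl
        have hNU : Uᵀ * -(Kᵀ * X⁻¹ * H * X⁻¹ * K) * U = -N := by
          simp only [hN, Matrix.transpose_mul, Matrix.mul_assoc, Matrix.neg_mul, Matrix.mul_neg]
        rw [hNU]
        set R : Matrix (Fin k) (Fin k) ℝ :=
          Matrix.of fun i j => dslope (fun z : ℝ => z ^ (r - 1)) (l i) (l j) * (-N) i j with hR
        have t1 : (X⁻¹ * H * X⁻¹ * K * (U * diagonal (fun i => l i ^ (r - 1)) * Uᵀ) *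
            (Kᵀ * X⁻¹ * H)).trace = ∑ i, l i ^ (r - 1) * S i i := by
          rw [show X⁻¹ * H * X⁻¹ * K * (U * diagonal (fun i => l i ^ (r - 1)) * Uᵀ) * (Kᵀ * X⁻¹ * H) =
            (X⁻¹ * H * X⁻¹ * K * U) * (diagonal (fun i => l i ^ (r - 1)) * (Uᵀ * Kᵀ * X⁻¹ * H)) by
              simp only [Matrix.mul_assoc], Matrix.trace_mul_comm,
            show diagonal (fun i => l i ^ (r - 1)) * (Uᵀ * Kᵀ * X⁻¹ * H) * (X⁻¹ * H * X⁻¹ * K * U) =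
              diagonal (fun i => l i ^ (r - 1)) * S by
              simp only [hS, Matrix.transpose_mul, Matrix.mul_assoc]]
          simp [Matrix.trace, Matrix.diagonal_mul]
        have t2 : (X⁻¹ * K * (U * diagonal (fun i => l i ^ (r - 1)) * Uᵀ) *
            (Kᵀ * X⁻¹ * H * X⁻¹ * H)).trace = ∑ i, l i ^ (r - 1) * S i i := by
          rw [show X⁻¹ * K * (U * diagonal (fun i => l i ^ (r - 1)) * Uᵀ) * (Kᵀ * X⁻¹ * H * X⁻¹ * H) =
            (X⁻¹ * K * U) * (diagonal (fun i => l i ^ (r - 1)) * (Uᵀ * Kᵀ * X⁻¹ * H * X⁻¹ * H)) by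
              simp only [Matrix.mul_assoc], Matrix.trace_mul_comm,
            show diagonal (fun i => l i ^ (r - 1)) * (Uᵀ * Kᵀ * X⁻¹ * H * X⁻¹ * H) * (X⁻¹ * K * U) =
              diagonal (fun i => l i ^ (r - 1)) * S by
              simp only [hS, Matrix.transpose_mul, Matrix.mul_assoc]]
          simp [Matrix.trace, Matrix.diagonal_mul]
        have t3 : (X⁻¹ * K * (U * R * Uᵀ) * (Kᵀ * X⁻¹ * H)).trace =
            -∑ i, ∑ j, dslope (fun z : ℝ => z ^ (r - 1)) (l i) (l j) * N i j ^ 2 := by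
          rw [show X⁻¹ * K * (U * R * Uᵀ) * (Kᵀ * X⁻¹ * H) =
            (X⁻¹ * K * U) * (R * (Uᵀ * Kᵀ * X⁻¹ * H)) by
              simp only [Matrix.mul_assoc], Matrix.trace_mul_comm,
            show R * (Uᵀ * Kᵀ * X⁻¹ * H) * (X⁻¹ * K * U) = R * N by
              simp only [hN, Matrix.transpose_mul, Matrix.mul_assoc]]
          simp only [Matrix.trace, Matrix.diag, Matrix.mul_apply, hR, Matrix.of_apply,
            Matrix.neg_apply, ← Finset.sum_neg_distrib]
          refine Finset.sum_congr rfl fun i _ => Finset.sum_congr rfl fun j _ => ?_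
          rw [hNs j i]; ring
        rw [Matrix.add_mul, Matrix.neg_mul, Matrix.neg_mul, Matrix.mul_neg, Matrix.trace_add,
          Matrix.trace_add, Matrix.trace_neg, Matrix.trace_neg, t1, t2, t3, hpr]
        ring
    refine ⟨_, hq, ?_⟩
    have hKU : (K * U)ᵀ * X⁻¹ * (K * U) = diagonal l := by
      calc (K * U)ᵀ * X⁻¹ * (K * U) = Uᵀ * (Kᵀ * X⁻¹ * K) * U := by
            simp only [Matrix.transpose_mul, Matrix.mul_assoc]
        _ = (Uᵀ * U) * diagonal l * (Uᵀ * U) := by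
            rw [hspec]; simp only [Matrix.mul_assoc]
        _ = _ := by rw [hUU, one_mul, mul_one]
    obtain ⟨g1, g2⟩ := core_pos (K * U) X⁻¹ H hW hH l hlpos r hrpos hKU
    refine ⟨mul_nonneg hrpos.le g1, fun h0 => ?_, fun h0 => ?_⟩
    · have h1 := g2 ((mul_eq_zero.1 h0).resolve_left hrpos.ne')
      calc Kᵀ * X⁻¹ * H = (U * Uᵀ) * Kᵀ * X⁻¹ * H := by rw [hUU', Matrix.one_mul]
        _ = U * ((K * U)ᵀ * X⁻¹ * H) := by simp only [Matrix.transpose_mul, Matrix.mul_assoc]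
        _ = 0 := by rw [h1, Matrix.mul_zero]
    · have h1 : (K * U)ᵀ * X⁻¹ * H = 0 := by
        rw [Matrix.transpose_mul, Matrix.mul_assoc, Matrix.mul_assoc, ← Matrix.mul_assoc Kᵀ, h0,
          Matrix.mul_zero]
      rw [h1]
      simp
end
end
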